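/- There exists a Hat tiling 𝐓 of ℝ² with cotiler C ⊆ Isom(ℝ²) whose stabilizer and symmetry group both equal a cyclic group of order 3 generated by a rotation of angle 2π/3: Stab(C) = Sym(𝐓) = {id, ρ, ρ²} for some rotation ρ by 2π/3 about a point of the plane. -/

import Mathlib

open MeasureTheory Complex

noncomputable section

/-- The group of isometries of the euclidean plane, identified with `ℂ`. -/
abbrev IsomC := ℂ ≃ᵢ ℂ

/-- The rotation of angle `θ` about the point `c`. -/
noncomputable def rotAbout (θ : ℝ) (c : ℂ) : IsomC :=
  (IsometryEquiv.addLeft (-c)).trans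
    ((rotation (Circle.exp θ)).toIsometryEquiv.trans (IsometryEquiv.addLeft c))

/-- `R6`: rotation by `π/3` about the origin. -/
noncomputable def R6 : IsomC := rotAbout (Real.pi / 3) 0
/-- `R3`: rotation by `2π/3` about `(2,0)`. -/
noncomputable def R3 : IsomC := rotAbout (2 * Real.pi / 3) 2

/-- The Kite: convex quadrilateral with vertices `(0,0)`, `(3/2,√3/2)`, `(2,0)`,
`(3/2,−√3/2)`. -/
def Kite : Set ℂ :=
  convexHull ℝ {0, ⟨3 / 2, Real.sqrt 3 / 2⟩, 2, ⟨3 / 2, -(Real.sqrt 3 / 2)⟩}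

/-- The Hat, a union of eight kites. -/
noncomputable def Hat : Set ℂ :=
  ⋃ g ∈ ({1, R6, R6⁻¹, R6⁻¹ * R6⁻¹, R3, R3 * R3, R3 * R6⁻¹, R3 * R3 * R6⁻¹} : Set IsomC),
    g '' Kite

/-- `C` is a cotiler for the Hat. -/
def IsHatCotiler (C : Set IsomC) : Prop :=
  C.Countable ∧
  (∀ g ∈ C, ∀ h ∈ C, g ≠ h → volume ((g '' Hat) ∩ (h '' Hat)) = 0) ∧
  volume ((⋃ g ∈ C, g '' Hat)ᶜ) = 0

/-- The Hat tiling associated to a cotiler. -/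
def hatTiling (C : Set IsomC) : Set (Set ℂ) := (fun g : IsomC => g '' Hat) '' C

/-- The symmetry group (as a set) of a tiling `Til`: isometries `h` with `hTil = Til`. -/
def SymGrp (Til : Set (Set ℂ)) : Set IsomC :=
  {h : IsomC | (fun S : Set ℂ => h '' S) '' Til = Til}

/-- The stabilizer (as a set) of a cotiler `C`: isometries `h` with `hC = C`. -/
def Stab (C : Set IsomC) : Set IsomC := {h : IsomC | (fun g : IsomC => h * g) '' C = C}

namespace HatC

/-- The ring of Eisenstein integers `ℤ[ω]`, `ω² = -1 - ω`. -/
abbrev E := QuadraticAlgebra ℤ (-1) (-1)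

/-- The sixth roots of unity of `E`. -/
def rt (k : ZMod 6) : E :=
  (![⟨1, 0⟩, ⟨1, 1⟩, ⟨0, 1⟩, ⟨-1, 0⟩, ⟨-1, -1⟩, ⟨0, -1⟩] : Fin 6 → E) k

theorem rt_zero : rt 0 = 1 := rfl

theorem rt_add (k l : ZMod 6) : rt (k + l) = rt k * rt l := by
  revert k l; decide

theorem rt_mul_neg (k : ZMod 6) : rt k * rt (-k) = 1 := by
  rw [← rt_add, add_neg_cancel, rt_zero]

/-- The motions `v ↦ ζ ^ k • v + x` of an `E`-module, `ζ` being a primitive sixth root of unity. -/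
@[ext]
structure Mot (V : Type) where
  k : ZMod 6
  x : V

namespace Mot

variable {V W : Type} [AddCommGroup V] [Module E V] [AddCommGroup W] [Module E W]

instance [DecidableEq V] : DecidableEq (Mot V) := fun g h =>
  decidable_of_iff (g.k = h.k ∧ g.x = h.x) Mot.ext_iff.symm

instance : Mul (Mot V) := ⟨fun g h => ⟨g.k + h.k, g.x + rt g.k • h.x⟩⟩
instance : One (Mot V) := ⟨⟨0, 0⟩⟩
instance : Inv (Mot V) := ⟨fun g => ⟨-g.k, -(rt (-g.k) • g.x)⟩⟩

theorem mul_k (g h : Mot V) : (g * h).k = g.k + h.k := rfl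
theorem mul_x (g h : Mot V) : (g * h).x = g.x + rt g.k • h.x := rfl
theorem one_k {V : Type} [AddCommGroup V] : (1 : Mot V).k = 0 := rfl
theorem one_x {V : Type} [AddCommGroup V] : (1 : Mot V).x = 0 := rfl
theorem inv_k (g : Mot V) : (g⁻¹).k = -g.k := rfl
theorem inv_x (g : Mot V) : (g⁻¹).x = -(rt (-g.k) • g.x) := rfl

instance : Group (Mot V) where
  mul_assoc a b c := by
    ext
    · simp [mul_k, add_assoc]
    · simp [mul_x, mul_k, rt_add, smul_add, mul_smul, add_assoc]
  one_mul a := by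
    ext
    · simp [mul_k, one_k]
    · simp [mul_x, one_x, one_k, rt_zero]
  mul_one a := by
    ext
    · simp [mul_k, one_k]
    · simp [mul_x, one_x]
  inv_mul_cancel a := by
    ext
    · simp [mul_k, one_k, inv_k]
    · simp [mul_x, one_x, inv_x, inv_k]

/-- Functoriality of `Mot`. -/
def map (f : V →ₗ[E] W) : Mot V →* Mot W where
  toFun g := ⟨g.k, f g.x⟩
  map_one' := by ext <;> simp [one_k, one_x]
  map_mul' g h := by ext <;> simp [mul_k, mul_x]

end Mot

/-- Addresses: a sequence `(d n)` of Eisenstein integers with `d (n+2) = 3 d (n+1) - d n` is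
given by `(d (-1), d 0)`. -/
abbrev A := E × E

/-- The shift on addresses. -/
def shift : A →ₗ[E] A where
  toFun z := (z.2, 3 * z.2 - z.1)
  map_add' x y := by ext1 <;> simp; ring
  map_smul' c x := by ext1 <;> simp; ring

/-- The `n`-th term of an address. -/
def term : ℕ → A →ₗ[E] E
  | 0 => LinearMap.snd E E E
  | n + 1 => (term n).comp shift

theorem term_succ (n : ℕ) (z : A) : term (n + 1) z = term n (shift z) := rfl

abbrev FMot := Mot A

/-- The shift on formal motions. -/
def sh : FMot →* FMot := Mot.map shift

/-- The actual motion at level `n` given by a formal motion. -/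
def ev (n : ℕ) : FMot →* Mot E := Mot.map (term n)

theorem ev_succ (n : ℕ) (g : FMot) : ev (n + 1) g = ev n (sh g) := rfl

/-- A decorated motion. -/
abbrev Cell := Mot E × ℕ

/-- Left translation of a decorated motion. -/
def act (g : Mot E) (c : Cell) : Cell := (g * c.1, c.2)

theorem act_mul (g h : Mot E) (c : Cell) : act (g * h) c = act g (act h c) := by
  simp [act, mul_assoc]

theorem act_one (c : Cell) : act 1 c = c := by simp [act]

/-- The symbols: four tile types and five types of edges. -/
inductive Symb
  | H | T | P | F | a | b | c | d | e
deriving DecidableEq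

abbrev FTerm := ℤ × Symb × FMot
abbrev CTerm := ℤ × Cell

def mo (k : ZMod 6) (a b c d : ℤ) : FMot := ⟨k, ⟨a, b⟩, ⟨c, d⟩⟩

def ce (k : ZMod 6) (a b : ℤ) (s : ℕ) : Cell := (⟨k, ⟨a, b⟩⟩, s)

/-- The substitution rule. -/
def sub : Symb → List FTerm
  | .H => [(1, .H, mo 0 0 0 0 0),
      (1, .H, mo 0 1 2 2 3),
      (1, .H, mo 4 0 1 (-1) 3),
      (1, .T, mo 5 2 3 1 3),
      (1, .P, mo 0 (-1) 2 (-2) 1),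
      (1, .F, mo 5 1 1 (-1) 0),
      (1, .P, mo 2 (-1) (-2) 2 1),
      (1, .F, mo 1 0 1 3 3),
      (1, .P, mo 1 (-1) 2 2 5),
      (1, .F, mo 3 0 0 0 4)]
  | .T => [(1, .H, mo 0 0 0 0 0)]
  | .P => [(1, .P, mo 1 (-2) 0 0 2),
      (1, .H, mo 0 0 0 0 0),
      (1, .F, mo 1 (-1) (-1) 1 0),
      (1, .F, mo 4 1 1 (-1) 4),
      (1, .H, mo 5 0 1 (-1) 3)]
  | .F => [(1, .F, mo 5 1 1 (-1) 0),
      (1, .H, mo 0 0 0 0 0),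
      (1, .P, mo 2 (-1) (-2) 2 1),
      (1, .H, mo 1 1 0 4 1),
      (1, .F, mo 0 1 1 3 0),
      (1, .F, mo 2 1 (-1) 5 2)]
  | .a => [(-1, .a, mo 3 (-2) 0 (-4) 2),
      (-1, .d, mo 0 (-2) 3 (-3) 3),
      (-1, .e, mo 1 (-3) 0 (-4) 1),
      (1, .a, mo 0 (-1) 1 (-1) 2)]
  | .b => [(-1, .a, mo 3 (-1) (-1) (-3) 0),
      (-1, .c, mo 5 (-1) 0 (-4) (-1)),
      (1, .a, mo 1 (-1) 1 (-1) 2)]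
  | .c => [(-1, .a, mo 1 0 2 2 6),
      (-1, .b, mo 1 0 2 2 6),
      (1, .a, mo 5 2 2 2 4)]
  | .d => [(-1, .a, mo 5 1 (-1) 1 (-2)),
      (-1, .d, mo 2 (-2) (-4) 0 (-2)),
      (1, .a, mo 2 0 (-1) 1 1)]
  | .e => [(-1, .a, mo 0 3 1 7 2),
      (-1, .e, mo 4 4 1 7 3),
      (1, .a, mo 3 2 0 4 2),
      (1, .d, mo 0 2 3 5 3)]

/-- The level zero realizations of the symbols: hats (decorated with `1` if reflected) for tile
types, and sides of kites for edges. -/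
def base : Symb → List CTerm
  | .H => [(1, ce 0 0 0 0),
      (1, ce 0 1 2 0),
      (1, ce 4 0 1 0),
      (1, ce 4 1 1 1)]
  | .T => [(1, ce 0 0 0 0)]
  | .P => [(1, ce 0 0 0 0),
      (1, ce 5 0 1 0)]
  | .F => [(1, ce 1 1 0 0),
      (1, ce 0 0 0 0)]
  | .a => [(-1, ce 1 (-2) 0 3),
      (-1, ce 4 (-1) 1 0)]
  | .b => [(-1, ce 0 (-1) 0 0),
      (-1, ce 0 (-1) 0 3),
      (-1, ce 2 (-1) (-1) 2),
      (1, ce 2 (-1) 0 0),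
      (-1, ce 3 (-1) 0 2),
      (-1, ce 1 (-1) (-1) 3)]
  | .c => [(-1, ce 0 0 2 2),
      (-1, ce 0 0 2 3),
      (1, ce 1 1 2 0),
      (1, ce 3 0 1 2),
      (-1, ce 3 1 2 0),
      (1, ce 1 1 2 3)]
  | .d => [(1, ce 0 0 (-1) 3),
      (1, ce 1 0 (-1) 2)]
  | .e => [(-1, ce 1 2 0 0),
      (1, ce 2 2 0 2)]

/-- The boundaries of tiles. -/
def bd : Symb → List FTerm
  | .H => [(1, .a, mo 0 0 0 0 0),
      (1, .b, mo 0 0 0 0 0),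
      (-1, .a, mo 4 0 (-2) (-2) (-2)),
      (1, .a, mo 2 0 (-1) 1 1),
      (1, .b, mo 2 0 (-1) 1 1),
      (-1, .a, mo 0 2 1 3 1),
      (1, .a, mo 4 1 0 0 1),
      (1, .c, mo 0 0 0 0 0),
      (-1, .a, mo 2 (-1) 0 0 3)]
  | .T => [(-1, .c, mo 5 0 (-2) (-2) (-2)),
      (-1, .c, mo 1 1 (-2) 2 (-1)),
      (-1, .b, mo 1 0 (-1) 1 1)]
  | .P => [(-1, .a, mo 3 (-1) (-2) (-2) 1),
      (1, .a, mo 1 0 (-1) 1 1),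
      (-1, .c, mo 5 0 (-2) (-2) (-2)),
      (1, .d, mo 0 0 0 0 0),
      (-1, .a, mo 0 1 (-2) 2 (-1)),
      (1, .a, mo 4 0 (-3) (-1) (-1)),
      (-1, .b, mo 0 0 (-1) 1 1),
      (1, .d, mo 3 0 (-4) 0 0)]
  | .F => [(-1, .d, mo 1 (-3) (-2) (-2) (-1)),
      (-1, .a, mo 4 0 (-2) (-2) (-2)),
      (1, .a, mo 2 0 (-1) 1 1),
      (-1, .d, mo 2 (-2) (-4) 0 (-2)),
      (-1, .a, mo 5 1 (-1) 1 (-2)),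
      (1, .e, mo 0 0 0 0 0),
      (-1, .e, mo 4 3 0 4 3),
      (1, .a, mo 5 2 (-1) 1 (-1)),
      (-1, .b, mo 1 0 (-1) 1 1)]
  | _ => []

def isTile : Symb → Bool
  | .H | .T | .P | .F => true
  | _ => false

/-- The level `n` realization of a symbol. -/
def chain : ℕ → Symb → List CTerm
  | 0, X => base X
  | n + 1, X => (sub X).flatMap fun t =>
      (chain n t.2.1).map fun c => (t.1 * c.1, act (ev n t.2.2) c.2)

/-- The sum of a function over a chain. -/
def val (φ : Cell → ℤ) (L : List CTerm) : ℤ := (L.map fun c => c.1 * φ c.2).sum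

/-- The sum of a function over the realization of a formal chain. -/
def fval (n : ℕ) (φ : Cell → ℤ) (L : List FTerm) : ℤ :=
  (L.map fun t => t.1 * val (fun c => φ (act (ev n t.2.2) c)) (chain n t.2.1)).sum

theorem val_append (φ : Cell → ℤ) (L M : List CTerm) : val φ (L ++ M) = val φ L + val φ M := by
  simp [val]

theorem val_flatMap {α : Type} (φ : Cell → ℤ) (L : List α) (f : α → List CTerm) :
    val φ (L.flatMap f) = (L.map fun x => val φ (f x)).sum := by
  induction L with
  | nil => simp [val]
  | cons x L ih => simp [List.flatMap_cons, val_append, ih]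

theorem val_scale (φ : Cell → ℤ) (s : ℤ) (f : Cell → Cell) (L : List CTerm) :
    val φ (L.map fun c => (s * c.1, f c.2)) = s * val (fun c => φ (f c)) L := by
  simp [val, List.map_map, Function.comp_def, mul_assoc, ← List.sum_map_mul_left]

theorem val_chain_succ (φ : Cell → ℤ) (n : ℕ) (X : Symb) :
    val φ (chain (n + 1) X) = fval n φ (sub X) := by
  simp only [chain, val_flatMap, val_scale, fval]

theorem fval_append (n : ℕ) (φ : Cell → ℤ) (L M : List FTerm) :
    fval n φ (L ++ M) = fval n φ L + fval n φ M := by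
  simp [fval]

theorem fval_flatMap {α : Type} (n : ℕ) (φ : Cell → ℤ) (L : List α) (f : α → List FTerm) :
    fval n φ (L.flatMap f) = (L.map fun x => fval n φ (f x)).sum := by
  induction L with
  | nil => simp [fval]
  | cons x L ih => simp [List.flatMap_cons, fval_append, ih]

/-- Scaling and left translation of a formal chain. -/
def tr (s : ℤ) (g : FMot) (L : List FTerm) : List FTerm :=
  L.map fun t => (s * t.1, t.2.1, g * t.2.2)

theorem fval_tr (n : ℕ) (φ : Cell → ℤ) (s : ℤ) (g : FMot) (L : List FTerm) :
    fval n φ (tr s g L) = s * fval n (fun c => φ (act (ev n g) c)) L := by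
  simp [fval, tr, List.map_map, Function.comp_def, mul_assoc, ← List.sum_map_mul_left, act_mul]

/-- The substitution rule on formal chains. -/
def subl (L : List FTerm) : List FTerm := L.flatMap fun t => tr t.1 (sh t.2.2) (sub t.2.1)

theorem fval_succ (n : ℕ) (φ : Cell → ℤ) (L : List FTerm) :
    fval (n + 1) φ L = fval n φ (subl L) := by
  simp only [subl, fval_flatMap, fval_tr]
  simp only [fval, val_chain_succ, ev_succ]

/-! ### Cancellation -/

section Cancel

variable {K : Type}

/-- Remove the first element satisfying a predicate. -/
def removeFirst (p : K → Bool) : List K → Option (List K)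
  | [] => none
  | x :: L => if p x then some L else (removeFirst p L).map (x :: ·)

/-- Whether the elements of a list can be paired off. -/
def cancels (m : K → K → Bool) : ℕ → List K → Bool
  | _, [] => true
  | 0, _ :: _ => false
  | n + 1, x :: L => match removeFirst (m x) L with
    | none => false
    | some L' => cancels m n L'

theorem removeFirst_sum (v : K → ℤ) (p : K → Bool) (L L' : List K)
    (h : removeFirst p L = some L') :
    ∃ y, p y = true ∧ (L.map v).sum = v y + (L'.map v).sum := by
  induction L generalizing L' with
  | nil => simp [removeFirst] at h
  | cons x L ih =>
    unfold removeFirst at h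
    split_ifs at h with hx
    · obtain rfl := Option.some.inj h
      exact ⟨x, hx, by simp⟩
    · obtain ⟨M, hM, rfl⟩ := Option.map_eq_some_iff.1 h
      obtain ⟨y, hy, e⟩ := ih M hM
      exact ⟨y, hy, by simp [e]; ring⟩

theorem sum_eq_zero_of_cancels (v : K → ℤ) (m : K → K → Bool)
    (hm : ∀ x y, m x y = true → v x + v y = 0) (n : ℕ) (L : List K) (h : cancels m n L = true) :
    (L.map v).sum = 0 := by
  induction n generalizing L with
  | zero => cases L <;> simp_all [cancels]
  | succ n ih =>
    cases L with
    | nil => simp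
    | cons x L =>
      unfold cancels at h
      split at h
      · simp at h
      · rename_i L' hL'
        obtain ⟨y, hy, e⟩ := removeFirst_sum v _ _ _ hL'
        have := hm x y hy
        have := ih L' h
        simp [e]; linarith

end Cancel

/-! ### Kites and hats -/

/-- A kite is an element of `Mot E`; its neighbour across side `s` is its product with `side s`. -/
def side : ℕ → Mot E
  | 0 => ⟨1, 0⟩
  | 1 => ⟨5, 0⟩
  | 2 => ⟨2, ⟨0, -1⟩⟩
  | 3 => ⟨4, ⟨1, 0⟩⟩
  | _ => 1

def opp : ℕ → ℕ
  | 0 => 1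
  | 1 => 0
  | 2 => 3
  | 3 => 2
  | n => n

/-- The side of a kite seen from the other side. -/
def rev (c : Cell) : Cell := (c.1 * side c.2, opp c.2)

theorem act_rev (g : Mot E) (c : Cell) : act g (rev c) = rev (act g c) := by
  simp [act, rev, mul_assoc]

theorem side_opp (s : ℕ) : side s * side (opp s) = 1 := by
  match s with
  | 0 | 1 | 2 | 3 => decide
  | n + 4 => simp [side, opp]

theorem opp_opp (s : ℕ) : opp (opp s) = s := by
  match s with
  | 0 | 1 | 2 | 3 => rfl
  | n + 4 => rfl

theorem rev_rev (c : Cell) : rev (rev c) = c := by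
  simp [rev, mul_assoc, side_opp, opp_opp]

/-- Flows through the sides of kites. -/
def IsFlow (φ : Cell → ℤ) : Prop := ∀ c : Cell, c.2 < 4 → φ (rev c) = -φ c

theorem IsFlow.act {φ : Cell → ℤ} (h : IsFlow φ) (g : Mot E) :
    IsFlow fun c => φ (HatC.act g c) := by
  intro c hc
  simp only [act_rev]
  exact h (HatC.act g c) hc

/-- The total flow out of a kite. -/
def dvg (φ : Cell → ℤ) (κ : Mot E) : ℤ := φ (κ, 0) + φ (κ, 1) + φ (κ, 2) + φ (κ, 3)

/-- The kites of a hat. -/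
def hatKites : ℕ → List (Mot E)
  | 0 => [⟨0, 0⟩, ⟨1, 0⟩, ⟨5, 0⟩, ⟨4, 0⟩, ⟨2, ⟨0, -1⟩⟩, ⟨4, ⟨1, 0⟩⟩, ⟨1, ⟨0, -1⟩⟩, ⟨3, ⟨1, 0⟩⟩]
  | _ => [⟨0, 0⟩, ⟨5, 0⟩, ⟨1, 0⟩, ⟨2, 0⟩, ⟨4, ⟨1, 0⟩⟩, ⟨2, ⟨0, -1⟩⟩, ⟨5, ⟨1, 0⟩⟩, ⟨3, ⟨0, -1⟩⟩]

/-- The kites of a placed hat. -/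
def kites (c : Cell) : List (Mot E) := (hatKites c.2).map (c.1 * ·)

/-- The sum of a function over the kites of a placed hat. -/
def hsum (ψ : Mot E → ℤ) (c : Cell) : ℤ := ((kites c).map ψ).sum

theorem kites_act (g : Mot E) (c : Cell) : kites (act g c) = (kites c).map (g * ·) := by
  simp [kites, act, mul_assoc]

theorem hsum_act (ψ : Mot E → ℤ) (g : Mot E) (c : Cell) :
    hsum ψ (act g c) = hsum (fun κ => ψ (g * κ)) c := by
  simp [hsum, kites_act, Function.comp_def]

theorem hsum_dvg_act (φ : Cell → ℤ) (g : Mot E) (c : Cell) :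
    hsum (dvg φ) (act g c) = hsum (dvg fun c => φ (act g c)) c := by
  rw [hsum_act]; rfl

/-! ### The boundary of a tile -/

/-- The sides of the kites of a placed hat. -/
def hatSides (t : CTerm) : List CTerm :=
  (kites t.2).flatMap fun κ => [(t.1, (κ, 0)), (t.1, (κ, 1)), (t.1, (κ, 2)), (t.1, (κ, 3))]

theorem val_hatSides (φ : Cell → ℤ) (t : CTerm) : val φ (hatSides t) = t.1 * hsum (dvg φ) t.2 := by
  rw [hatSides, val_flatMap, hsum, ← List.sum_map_mul_left]
  congr 2
  ext κ
  simp [val, dvg]; ring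

/-- The level zero realization of a formal chain. -/
def real0 (L : List FTerm) : List CTerm :=
  L.flatMap fun t => (base t.2.1).map fun c => (t.1 * c.1, act (ev 0 t.2.2) c.2)

theorem val_real0 (φ : Cell → ℤ) (L : List FTerm) : val φ (real0 L) = fval 0 φ L := by
  simp only [real0, val_flatMap, val_scale, fval, chain]

/-- Whether two oriented sides cancel. -/
def sidesCancel (x y : CTerm) : Bool :=
  (x.2 == y.2 && x.1 == -y.1) || (decide (x.2.2 < 4) && y.2 == rev x.2 && x.1 == y.1)

theorem val_eq_zero_of_cancels {φ : Cell → ℤ} (h : IsFlow φ) (n : ℕ) (L : List CTerm)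
    (hL : cancels sidesCancel n L = true) : val φ L = 0 := by
  refine sum_eq_zero_of_cancels (fun c : CTerm => c.1 * φ c.2) _ (fun x y hxy => ?_) n L hL
  simp only [sidesCancel, Bool.or_eq_true, Bool.and_eq_true, beq_iff_eq, decide_eq_true_eq] at hxy
  rcases hxy with ⟨h1, h2⟩ | ⟨⟨h0, h1⟩, h2⟩
  · simp [h1, h2]
  · simp [h1, h2, h _ h0]

theorem cancels_base : ∀ X : Symb, isTile X = true →
    cancels sidesCancel 200 ((base X).flatMap hatSides ++ real0 (tr (-1) 1 (bd X))) = true := by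
  intro X
  cases X <;> decide +kernel

/-- The motion mapping an edge of type `d` to its opposite. -/
def flip : FMot := mo 3 1 (-5) 1 (-2)

theorem cancels_flip_base :
    cancels sidesCancel 10 (real0 [(1, .d, 1), (1, .d, flip)]) = true := by
  decide +kernel

/-- Whether two formal oriented edges cancel. -/
def edgesCancel (x y : FTerm) : Bool :=
  (x.2 == y.2 && x.1 == -y.1) ||
    (x.2.1 == .d && y.2.1 == .d && (y.2.2 == x.2.2 * flip || x.2.2 == y.2.2 * flip) && x.1 == y.1)

/-- An edge of type `d` is opposite to its flip. -/
def FlipRel (n : ℕ) : Prop := ∀ φ, IsFlow φ → fval n φ [(1, .d, 1), (1, .d, flip)] = 0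

theorem fval_eq_zero_of_cancels {φ : Cell → ℤ} (h : IsFlow φ) {n : ℕ} (hn : FlipRel n) (m : ℕ)
    (L : List FTerm) (hL : cancels edgesCancel m L = true) : fval n φ L = 0 := by
  have key : ∀ g : FMot, val (fun c => φ (act (ev n g) c)) (chain n .d) +
      val (fun c => φ (act (ev n (g * flip)) c)) (chain n .d) = 0 := fun g => by
    have := hn _ (h.act (ev n g))
    simpa [fval, act_mul, act_one] using this
  refine sum_eq_zero_of_cancels (fun t : FTerm =>
    t.1 * val (fun c => φ (act (ev n t.2.2) c)) (chain n t.2.1)) _ (fun x y hxy => ?_) m L hL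
  obtain ⟨x1, X, g⟩ := x
  obtain ⟨y1, Y, g'⟩ := y
  simp only [edgesCancel, Bool.or_eq_true, Bool.and_eq_true, beq_iff_eq, Prod.mk.injEq] at hxy
  rcases hxy with ⟨⟨rfl, rfl⟩, rfl⟩ | ⟨⟨⟨rfl, rfl⟩, rfl | rfl⟩, rfl⟩
  · ring
  · linear_combination x1 * key g
  · linear_combination x1 * key g'

theorem flipRel (n : ℕ) : FlipRel n := by
  induction n with
  | zero =>
    intro φ h
    rw [← val_real0]
    exact val_eq_zero_of_cancels h _ _ cancels_flip_base
  | succ n ih =>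
    intro φ h
    rw [fval_succ]
    refine fval_eq_zero_of_cancels h ih 10 _ ?_
    decide +kernel

theorem tile_cancels : ∀ X : Symb, isTile X = true →
    cancels edgesCancel 200 ((sub X).flatMap (fun t => tr t.1 t.2.2 (bd t.2.1)) ++
      subl (tr (-1) 1 (bd X))) = true ∧ ∀ t ∈ sub X, isTile t.2.1 = true := by
  intro X
  cases X <;> decide +kernel

/-- The total flow out of a tile is the flow through its boundary. -/
theorem val_dvg_chain {φ : Cell → ℤ} (h : IsFlow φ) (n : ℕ) (X : Symb) (hX : isTile X = true) :
    val (hsum (dvg φ)) (chain n X) = fval n φ (bd X) := by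
  induction n generalizing φ X with
  | zero =>
    have := val_eq_zero_of_cancels h _ _ (cancels_base X hX)
    rw [val_append, val_flatMap, val_real0, fval_tr] at this
    simp only [val_hatSides, map_one, act_one] at this
    simp only [chain]
    change val (hsum (dvg φ)) (base X) + _ = 0 at this
    linarith
  | succ n ih =>
    have := fval_eq_zero_of_cancels h (flipRel n) _ _ (tile_cancels X hX).1
    rw [fval_append, fval_flatMap, ← fval_succ, fval_tr] at this
    simp only [map_one, act_one, fval_tr] at this
    rw [val_chain_succ]
    have e : fval n (hsum (dvg φ)) (sub X) =
        ((sub X).map fun t => t.1 * fval n (fun c => φ (act (ev n t.2.2) c)) (bd t.2.1)).sum := by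
      simp only [fval]
      congr 1
      refine List.map_congr_left fun t ht => ?_
      have := ih (h.act (ev n t.2.2)) t.2.1 ((tile_cancels X hX).2 t ht)
      simp only [fval] at this
      rw [← this]
      simp only [hsum_dvg_act]
    rw [e]
    linarith

/-! ### Estimates -/

/-- The hexagonal norm on `E`. -/
def nrm (x : E) : ℤ := max |x.re| (max |x.im| |x.re - x.im|)

theorem nrm_rt_mul (k : ZMod 6) (x : E) : nrm (rt k * x) = nrm x := by
  have h : ∀ x : E, nrm (rt 1 * x) = nrm x := fun x => by
    simp only [nrm, rt, QuadraticAlgebra.re_mul, QuadraticAlgebra.im_mul]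
    simp
    grind
  have h' : ∀ (m : ℕ), nrm (rt (m : ZMod 6) * x) = nrm x := fun m => by
    induction m with
    | zero => simp [rt_zero]
    | succ m ih => rw [Nat.cast_succ, add_comm, rt_add, mul_assoc, h, ih]
  simpa using h' k.val

theorem nrm_add_le (x y : E) : nrm (x + y) ≤ nrm x + nrm y := by
  have h1 := abs_add_le x.re y.re
  have h2 := abs_add_le x.im y.im
  have h3 := abs_add_le (x.re - x.im) (y.re - y.im)
  rw [show x.re - x.im + (y.re - y.im) = x.re + y.re - (x.im + y.im) by ring] at h3
  simp only [nrm, QuadraticAlgebra.re_add, QuadraticAlgebra.im_add]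
  omega

theorem nrm_neg (x : E) : nrm (-x) = nrm x := by
  simp only [nrm, QuadraticAlgebra.re_neg, QuadraticAlgebra.im_neg]
  grind

theorem nrm_sub_le (x y : E) : nrm (x - y) ≤ nrm x + nrm y := by
  rw [sub_eq_add_neg, ← nrm_neg y]; exact nrm_add_le _ _

theorem nrm_sub_ge (x y : E) : nrm x - nrm y ≤ nrm (x - y) := by
  have := nrm_add_le (x - y) y
  rw [sub_add_cancel] at this; linarith

theorem nrm_three_mul (x : E) : nrm (3 * x) = 3 * nrm x := by
  have h : (3 : E) * x = x + x + x := by ring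
  rw [h]
  simp only [nrm, QuadraticAlgebra.re_add, QuadraticAlgebra.im_add]
  grind

/-- A quantity which roughly doubles along the shift. -/
def growth (z : A) : ℤ := 2 * nrm z.2 - nrm z.1

theorem nrm_nonneg (x : E) : 0 ≤ nrm x := by simp [nrm]

theorem growth_shift (z : A) : 2 * growth z ≤ growth (shift z) := by
  have := nrm_sub_ge (3 * z.2) z.1
  rw [nrm_three_mul] at this
  have h := nrm_nonneg z.2
  simp only [growth, shift, LinearMap.coe_mk, AddHom.coe_mk]
  linarith

theorem growth_rt_smul (k : ZMod 6) (z : A) : growth (rt k • z) = growth z := by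
  simp [growth, nrm_rt_mul]

theorem growth_sub (z w : A) : growth z - (2 * nrm w.2 + nrm w.1) ≤ growth (z - w) := by
  have h1 := nrm_sub_ge z.2 w.2
  have h2 := nrm_sub_le z.1 w.1
  simp only [growth, Prod.fst_sub, Prod.snd_sub]
  linarith

/-- The point `z` seen from `g`; addresses of points are multiplied by `3`. -/
def step (z : A) (g : FMot) : A := rt (-g.k) • (z - (3 : E) • g.x)

/-- The distance of a cell to a point. -/
def dist3 (c : Cell) (z : E) : ℤ := nrm (3 * c.1.x - z)

theorem dist3_act (n : ℕ) (g : FMot) (z : A) (c : Cell) :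
    dist3 (act (ev n g) c) (term n z) = dist3 c (term n (step z g)) := by
  have e : 3 * (act (ev n g) c).1.x - term n z =
      rt g.k * (3 * c.1.x - term n (step z g)) := by
    simp only [act, Mot.mul_x, ev, Mot.map, MonoidHom.coe_mk, OneHom.coe_mk, step, map_smul,
      map_sub, smul_eq_mul]
    linear_combination (term n z - 3 * term n g.x) * rt_mul_neg g.k
  rw [dist3, e, nrm_rt_mul]; rfl

theorem sub_growth : ∀ X, ∀ t ∈ sub X,
    2 * nrm ((3 : E) • t.2.2.x).2 + nrm ((3 : E) • t.2.2.x).1 ≤ 54 := by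
  intro X; cases X <;> decide +kernel

theorem base_nrm : ∀ X, ∀ c ∈ base X, nrm c.2.1.x ≤ 2 := by
  intro X; cases X <;> decide +kernel

theorem growth_step (X : Symb) (t : FTerm) (ht : t ∈ sub X) (z : A) :
    2 * growth z - 54 ≤ growth (step (shift z) t.2.2) := by
  rw [step, growth_rt_smul]
  have h1 := growth_sub (shift z) ((3 : E) • t.2.2.x)
  have h2 := growth_shift z
  have h3 := sub_growth X t ht
  linarith

theorem mem_chain_succ {n : ℕ} {X : Symb} {c : CTerm} (hc : c ∈ chain (n + 1) X) :
    ∃ t ∈ sub X, ∃ c' ∈ chain n t.2.1, c = (t.1 * c'.1, act (ev n t.2.2) c'.2) := by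
  simp only [chain, List.mem_flatMap, List.mem_map] at hc
  obtain ⟨t, ht, c', hc', rfl⟩ := hc
  exact ⟨t, ht, c', hc', rfl⟩

theorem far_of_growth {B t : ℤ} {n : ℕ} {X : Symb} {z : A} (hz : 54 + t ≤ growth z)
    (hB : 2 * (B + 6) < 54 + 2 ^ n * t) : ∀ c ∈ chain n X, B < dist3 c.2 (term n z) := by
  induction n generalizing t X z with
  | zero =>
    intro c hc
    have h1 := base_nrm X c hc
    have h2 := nrm_sub_ge z.2 (3 * c.2.1.x)
    rw [← nrm_neg (z.2 - _), neg_sub, nrm_three_mul] at h2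
    have h3 := nrm_nonneg z.1
    simp only [growth, pow_zero] at hz hB
    simp only [dist3, term, LinearMap.snd_apply]
    linarith
  | succ n ih =>
    intro c hc
    obtain ⟨s, hs, c', hc', rfl⟩ := mem_chain_succ hc
    rw [term_succ, dist3_act]
    have := growth_step X s hs z
    exact ih (t := 2 * t) (by linarith) (by rw [pow_succ] at hB; linarith) c' hc'

/-- Whether a tile or an edge is seen to be far from a point. -/
def avoid : ℕ → Symb → A → Bool
  | 0, _, z => decide (55 ≤ growth z)
  | d + 1, X, z => decide (55 ≤ growth z) ||
      (sub X).all fun t => avoid d t.2.1 (step (shift z) t.2.2)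

theorem far_of_growth_ge {B : ℤ} {d n : ℕ} {X : Symb} {z : A} (hz : 55 ≤ growth z)
    (hB : 2 * (B + 6) < 54 + 2 ^ (n - d)) : ∀ c ∈ chain n X, B < dist3 c.2 (term n z) := by
  refine far_of_growth (t := 1) (by linarith) (hB.trans_le ?_)
  have : (2 : ℤ) ^ (n - d) ≤ 2 ^ n := pow_le_pow_right₀ (by norm_num) (by omega)
  linarith

theorem far_of_avoid {B : ℤ} {d n : ℕ} {X : Symb} {z : A} (h : avoid d X z = true) (hn : d ≤ n)
    (hB : 2 * (B + 6) < 54 + 2 ^ (n - d)) : ∀ c ∈ chain n X, B < dist3 c.2 (term n z) := by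
  induction d generalizing n X z with
  | zero => exact far_of_growth_ge (by simpa [avoid] using h) hB
  | succ d ih =>
    simp only [avoid, Bool.or_eq_true, decide_eq_true_eq, List.all_eq_true] at h
    rcases h with h | h
    · exact far_of_growth_ge h hB
    · obtain ⟨m, rfl⟩ := Nat.exists_eq_add_of_le' (Nat.one_le_of_lt hn)
      intro c hc
      obtain ⟨s, hs, c', hc', rfl⟩ := mem_chain_succ hc
      rw [term_succ, dist3_act]
      rw [Nat.add_sub_add_right] at hB
      exact ih (h s hs) (by omega) hB c' hc'

/-! ### The seed -/

/-- The formal rotation of order three of the seed. -/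
def gen : FMot := mo 2 0 (-3) 3 (-1)

/-- The position of a tile of type `F` of level `2 * m` in such a tile of level `2 * m + 2`. -/
def hook : FMot := sh (mo 2 1 (-1) 5 2) * mo 5 1 1 (-1) 0

/-- The address of the centre of rotation. -/
def ctr : A := (⟨3, -3⟩, ⟨7, 2⟩)

/-- The position of the tiles of level `2 * m`. -/
def top : ℕ → Mot E
  | 0 => 1
  | m + 1 => top m * (ev (2 * m) hook)⁻¹

def seed : List FTerm := [(1, .F, 1), (1, .F, gen), (1, .F, gen * gen)]

/-- The realization of a formal chain. -/
def realize (n : ℕ) (L : List FTerm) : List CTerm :=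
  L.flatMap fun t => (chain n t.2.1).map fun c => (t.1 * c.1, act (ev n t.2.2) c.2)

theorem val_realize (n : ℕ) (φ : Cell → ℤ) (L : List FTerm) :
    val φ (realize n L) = fval n φ L := by
  simp only [realize, val_flatMap, val_scale, fval]

/-- The `m`-th patch. -/
def patch (m : ℕ) : List CTerm := (realize (2 * m) seed).map fun c => (1 * c.1, act (top m) c.2)

theorem val_patch (m : ℕ) (φ : Cell → ℤ) :
    val φ (patch m) = fval (2 * m) (fun c => φ (act (top m) c)) seed := by
  rw [patch, val_scale, one_mul, val_realize]

theorem dist3_top (m : ℕ) (c : Cell) :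
    dist3 (act (top m) c) ctr.2 = dist3 c (term (2 * m) ctr) := by
  induction m generalizing c with
  | zero => simp [top, act_one, term]
  | succ m ih =>
    rw [top, act_mul, ih, ← map_inv, dist3_act, show step ctr hook⁻¹ = shift (shift ctr) by
      decide +kernel]
    rfl

theorem fval_filter (n : ℕ) (φ : Cell → ℤ) (p : FTerm → Bool) (L : List FTerm) :
    fval n φ L = fval n φ (L.filter p) + fval n φ (L.filter (fun t => !p t)) := by
  induction L with
  | nil => simp [fval]
  | cons x L ih =>
    simp only [fval, List.map_cons, List.sum_cons] at ih ⊢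
    cases h : p x <;> simp [h, ih] <;> ring

theorem val_eq_zero {φ : Cell → ℤ} {L : List CTerm} (h : ∀ c ∈ L, φ c.2 = 0) : val φ L = 0 := by
  refine List.sum_eq_zero fun x hx => ?_
  obtain ⟨c, hc, rfl⟩ := List.mem_map.1 hx
  rw [h c hc, mul_zero]

/-- Whether a formal cell is far from the point `z`. -/
def away (d : ℕ) (z : A) (t : FTerm) : Bool := avoid d t.2.1 (step z t.2.2)

theorem fval_away {B : ℤ} {d n : ℕ} {z : A} {φ : Cell → ℤ}
    (hφ : ∀ c, B < dist3 c (term n z) → φ c = 0) (hn : d ≤ n)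
    (hB : 2 * (B + 6) < 54 + 2 ^ (n - d)) (L : List FTerm) :
    fval n φ L = fval n φ (L.filter fun t => !away d z t) := by
  rw [fval_filter n φ (away d z), add_eq_right]
  refine List.sum_eq_zero fun x hx => ?_
  obtain ⟨t, ht, rfl⟩ := List.mem_map.1 hx
  rw [val_eq_zero, mul_zero]
  intro c hc
  apply hφ
  rw [dist3_act]
  exact far_of_avoid (List.mem_filter.1 ht).2 hn hB c hc

theorem fval_hsum_dvg {φ : Cell → ℤ} (h : IsFlow φ) (n : ℕ) (L : List FTerm)
    (hL : ∀ t ∈ L, isTile t.2.1 = true) :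
    fval n (hsum (dvg φ)) L = fval n φ (L.flatMap fun t => tr t.1 t.2.2 (bd t.2.1)) := by
  rw [fval_flatMap]
  simp only [fval_tr]
  simp only [fval]
  congr 1
  refine List.map_congr_left fun t ht => ?_
  have := val_dvg_chain (h.act (ev n t.2.2)) n t.2.1 (hL t ht)
  simp only [fval] at this
  rw [← this]
  simp only [hsum_dvg_act]

/-- No flow leaves the patches near the centre. -/
theorem patch_flow {B : ℤ} {m : ℕ} (hm : 3 ≤ 2 * m) (hB : 2 * (B + 6) < 54 + 2 ^ (2 * m - 3))
    {φ : Cell → ℤ} (h : IsFlow φ) (hφ : ∀ c, B < dist3 c ctr.2 → φ c = 0) :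
    val (hsum (dvg φ)) (patch m) = 0 := by
  rw [val_patch]
  simp only [hsum_dvg_act]
  rw [fval_hsum_dvg (h.act _) _ _ (by decide), fval_away (z := ctr) (fun c hc => ?_) hm hB]
  · exact fval_eq_zero_of_cancels (h.act _) (flipRel _) 30 _ (by decide +kernel)
  · exact hφ _ (by rwa [dist3_top])

theorem dist3_kites (c : Cell) (z : E) : ∀ κ ∈ kites c, dist3 c z - 3 ≤ dist3 (κ, 0) z := by
  intro κ hκ
  obtain ⟨y, hy, rfl⟩ := List.mem_map.1 hκ
  have h1 : nrm y.x ≤ 1 := by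
    obtain ⟨g, s⟩ := c
    have : ∀ s, ∀ y ∈ hatKites s, nrm y.x ≤ 1
      | 0 => by decide
      | _ + 1 => by simp only [hatKites]; decide
    exact this s y hy
  have h2 := nrm_sub_le (3 * (c.1 * y).x - z) (3 * (rt c.1.k * y.x))
  rw [nrm_three_mul, nrm_rt_mul] at h2
  have e : 3 * (c.1 * y).x - z - 3 * (rt c.1.k * y.x) = 3 * c.1.x - z := by
    rw [Mot.mul_x, smul_eq_mul]; ring
  rw [e] at h2
  simp only [dist3]
  linarith

theorem hsum_far {B : ℤ} {z : E} {ψ : Mot E → ℤ} (hψ : ∀ κ, B < dist3 (κ, 0) z → ψ κ = 0)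
    (c : Cell) (hc : B + 3 < dist3 c z) : hsum ψ c = 0 := by
  refine List.sum_eq_zero fun x hx => ?_
  obtain ⟨κ, hκ, rfl⟩ := List.mem_map.1 hx
  have := dist3_kites c z κ hκ
  exact hψ κ (by linarith)

theorem hook_gen :
    ((tr 1 hook⁻¹ (subl (subl seed))).filter fun t => !away 3 ctr t) = seed := by
  decide +kernel

theorem val_patch_succ (m : ℕ) (φ : Cell → ℤ) : val φ (patch (m + 1)) =
    fval (2 * m) (fun c => φ (act (top m) c)) (tr 1 hook⁻¹ (subl (subl seed))) := by
  rw [val_patch, mul_add, fval_succ, fval_succ, fval_tr, one_mul]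
  simp only [top, act_mul, map_inv]

theorem patch_stable {m : ℕ} (hm : 2 ≤ m) {φ : Cell → ℤ}
    (hφ : ∀ c, 21 < dist3 c ctr.2 → φ c = 0) : val φ (patch (m + 1)) = val φ (patch m) := by
  have : (1 : ℤ) ≤ 2 ^ (2 * m - 3) := one_le_pow₀ (by norm_num)
  rw [val_patch_succ, fval_away (B := 21) (d := 3) (z := ctr) (fun c hc => ?_) (by omega)
    (by linarith), hook_gen, val_patch]
  exact hφ _ (by rwa [dist3_top])

/-- The part near a point of a realization. -/
def near : ℕ → A → List FTerm → List FTerm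
  | 0, z, L => L.filter fun t => !away 0 z t
  | n + 1, z, L => near n (shift z) (subl (L.filter fun t => !away 0 z t))

theorem fval_near {n : ℕ} {z : A} {φ : Cell → ℤ} (hφ : ∀ c, 21 < dist3 c (term n z) → φ c = 0)
    (L : List FTerm) : fval n φ L = fval 0 φ (near n z L) := by
  have : ∀ n : ℕ, (1 : ℤ) ≤ 2 ^ (n - 0) := fun n => one_le_pow₀ (by norm_num)
  induction n generalizing z L with
  | zero => rw [fval_away hφ le_rfl (by norm_num)]; rfl
  | succ n ih =>
    rw [fval_away hφ (Nat.zero_le _) (by linarith [this (n + 1)]), fval_succ, ih hφ]; rfl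

/-- A kite around the centre. -/
def kite0 : Mot E := ⟨0, ⟨2, 1⟩⟩

def ind (κ : Mot E) (κ' : Mot E) : ℤ := if κ' = κ then 1 else 0

theorem hsum_kite0 (c : Cell) (hc : 21 < dist3 c ctr.2) : hsum (ind kite0) c = 0 := by
  refine hsum_far (B := 18) (z := ctr.2) (fun κ hκ => if_neg ?_) c (by linarith)
  rintro rfl
  revert hκ
  decide

theorem patch_two_kite0 : val (hsum (ind kite0)) (patch 2) = 1 := by
  rw [val_patch, fval_near (z := ctr) (fun c hc => hsum_kite0 _ (by rwa [dist3_top]))]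
  decide +kernel

theorem patch_kite0 {m : ℕ} (hm : 2 ≤ m) : val (hsum (ind kite0)) (patch m) = 1 := by
  induction m, hm using Nat.le_induction with
  | base => exact patch_two_kite0
  | succ m hm ih => rw [patch_stable hm hsum_kite0, ih]

/-! ### The combinatorial tiling -/

theorem hsum_sub (ψ χ : Mot E → ℤ) (c : Cell) :
    hsum (fun κ => ψ κ - χ κ) c = hsum ψ c - hsum χ c := by
  simp only [hsum]
  induction kites c with
  | nil => simp
  | cons x L ih => simp only [List.map_cons, List.sum_cons, ih]; ring

theorem val_sub (φ χ : Cell → ℤ) (L : List CTerm) :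
    val (fun c => φ c - χ c) L = val φ L - val χ L := by
  simp only [val]
  induction L with
  | nil => simp
  | cons x L ih => simp only [List.map_cons, List.sum_cons, ih]; ring

/-- The unit flow through one side. -/
def unitFlow (x c : Cell) : ℤ := (if c = x then 1 else 0) - (if c = rev x then 1 else 0)

theorem isFlow_unitFlow (x : Cell) : IsFlow (unitFlow x) := by
  intro c _
  have h1 : rev c = rev x ↔ c = x := ⟨fun h => by rw [← rev_rev c, h, rev_rev], fun h => by rw [h]⟩
  have h2 : rev c = x ↔ c = rev x :=
    ⟨fun h => by rw [← h, rev_rev], fun h => by rw [h, rev_rev]⟩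
  simp only [unitFlow, h1, h2]
  ring

theorem dvg_sub (φ χ : Cell → ℤ) (κ : Mot E) :
    dvg (fun c => φ c - χ c) κ = dvg φ κ - dvg χ κ := by
  simp only [dvg]; ring

theorem dvg_ite (κ κ' : Mot E) {s : ℕ} (hs : s < 4) :
    dvg (fun c => if c = (κ, s) then 1 else 0) κ' = ind κ κ' := by
  by_cases h : κ' = κ <;> interval_cases s <;> simp [dvg, ind, h]

theorem dvg_unitFlow (κ : Mot E) {s : ℕ} (hs : s < 4) (κ' : Mot E) :
    dvg (unitFlow (κ, s)) κ' = ind κ κ' - ind (κ * side s) κ' := by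
  have h : opp s < 4 := by interval_cases s <;> decide
  rw [← dvg_ite κ κ' hs, ← dvg_ite (κ * side s) κ' h]
  exact dvg_sub _ _ κ'

theorem eventually_lt_two_pow (B : ℤ) :
    ∀ᶠ m : ℕ in Filter.atTop, 3 ≤ 2 * m ∧ 2 * (B + 6) < 54 + 2 ^ (2 * m - 3) := by
  filter_upwards [Filter.eventually_ge_atTop ((2 * (B + 6)).toNat + 3)] with m hm
  refine ⟨by omega, ?_⟩
  have h1 : 2 * (B + 6) ≤ ((2 * m - 3 : ℕ) : ℤ) := by omega
  have h2 : ((2 * m - 3 : ℕ) : ℤ) < 2 ^ (2 * m - 3) := by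
    exact_mod_cast Nat.lt_two_pow_self
  linarith

theorem patch_side (κ : Mot E) {s : ℕ} (hs : s < 4) : ∀ᶠ m in Filter.atTop,
    val (hsum (ind κ)) (patch m) = val (hsum (ind (κ * side s))) (patch m) := by
  filter_upwards [eventually_lt_two_pow
    (max (dist3 (κ, s) ctr.2) (dist3 (rev (κ, s)) ctr.2))] with m ⟨h1, h2⟩
  have := patch_flow h1 h2 (isFlow_unitFlow (κ, s)) fun c hc => by
    rw [max_lt_iff] at hc
    have e1 : c ≠ (κ, s) := by rintro rfl; exact lt_irrefl _ hc.1
    have e2 : c ≠ rev (κ, s) := by rintro rfl; exact lt_irrefl _ hc.2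
    simp [unitFlow, e1, e2]
  have e : dvg (unitFlow (κ, s)) = fun κ' => ind κ κ' - ind (κ * side s) κ' :=
    funext (dvg_unitFlow κ hs)
  rw [e] at this
  have e' : hsum (fun κ' => ind κ κ' - ind (κ * side s) κ') =
      fun c => hsum (ind κ) c - hsum (ind (κ * side s)) c := funext (hsum_sub _ _)
  rw [e', val_sub] at this
  linarith

/-- A subgroup of `Mot E` containing the sides is the whole group. -/
theorem eq_top_of_sides (G : Subgroup (Mot E)) (h : ∀ s < 4, side s ∈ G) : G = ⊤ := by
  have hk : ∀ k : ZMod 6, (⟨k, 0⟩ : Mot E) ∈ G := fun k => by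
    have : ∀ m : ℕ, (⟨(m : ZMod 6), 0⟩ : Mot E) ∈ G := fun m => by
      induction m with
      | zero => exact G.one_mem
      | succ m ih =>
        have := G.mul_mem ih (h 0 (by norm_num))
        convert this using 1
        ext1
        · simp [Mot.mul_k, side]
        · simp [Mot.mul_x, side]
    simpa using this k.val
  let T : AddSubgroup E :=
    { carrier := {x | (⟨0, x⟩ : Mot E) ∈ G}
      zero_mem' := G.one_mem
      add_mem' := fun {x y} hx hy => by
        have := G.mul_mem hx hy
        change (⟨0, x + y⟩ : Mot E) ∈ G
        convert this using 1
        ext1 <;> simp [Mot.mul_k, Mot.mul_x, rt_zero]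
      neg_mem' := fun {x} hx => by
        have := G.inv_mem hx
        change (⟨0, -x⟩ : Mot E) ∈ G
        convert this using 1
        ext1 <;> simp [Mot.inv_k, Mot.inv_x, rt_zero] }
  have h1 : (1 : E) ∈ T := by
    have := G.mul_mem (h 3 (by norm_num)) (hk 2)
    exact this
  have h2 : (⟨0, 1⟩ : E) ∈ T := by
    have := G.inv_mem (G.mul_mem (h 2 (by norm_num)) (hk 4))
    exact this
  refine (Subgroup.eq_top_iff' G).2 fun g => ?_
  have h3 : g.x ∈ T := by
    have := T.add_mem (T.zsmul_mem h1 g.x.re) (T.zsmul_mem h2 g.x.im)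
    convert this using 1
    ext <;> simp
  have := G.mul_mem h3 (hk g.k)
  convert this using 1
  ext1 <;> simp [Mot.mul_k, Mot.mul_x]

theorem patch_kite (κ : Mot E) : ∀ᶠ m in Filter.atTop, val (hsum (ind κ)) (patch m) = 1 := by
  let G : Subgroup (Mot E) :=
    { carrier := {g | ∀ κ, ∀ᶠ m in Filter.atTop,
        val (hsum (ind κ)) (patch m) = val (hsum (ind (κ * g))) (patch m)}
      one_mem' := fun κ => by simp
      mul_mem' := fun {a b} ha hb κ => by
        filter_upwards [ha κ, hb (κ * a)] with m h1 h2
        rw [h1, h2, mul_assoc]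
      inv_mem' := fun {a} ha κ => by
        filter_upwards [ha (κ * a⁻¹)] with m h1
        rw [h1, inv_mul_cancel_right] }
  have hG := eq_top_of_sides G fun s hs κ => patch_side κ hs
  have : kite0⁻¹ * κ ∈ G := hG ▸ Subgroup.mem_top _
  filter_upwards [this kite0, Filter.eventually_ge_atTop 2] with m h1 h2
  rw [← patch_kite0 h2, h1, mul_inv_cancel_left]

theorem chain_tile {X : Symb} (hX : isTile X = true) (n : ℕ) :
    ∀ c ∈ chain n X, c.1 = 1 ∧ c.2.2 < 2 := by
  induction n generalizing X with
  | zero =>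
    have : ∀ X, isTile X = true → ∀ c ∈ base X, c.1 = 1 ∧ c.2.2 < 2 := by
      intro X; cases X <;> decide +kernel
    exact this X hX
  | succ n ih =>
    intro c hc
    obtain ⟨t, ht, c', hc', rfl⟩ := mem_chain_succ hc
    have h1 : ∀ X, isTile X = true → ∀ t ∈ sub X, t.1 = 1 := by
      intro X; cases X <;> decide +kernel
    have h2 := ih ((tile_cancels X hX).2 t ht) c' hc'
    simp [h1 X hX t ht, h2, act]

theorem mem_patch {m : ℕ} {t : CTerm} (h : t ∈ patch m) : t.1 = 1 ∧ t.2.2 < 2 := by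
  simp only [patch, realize, List.mem_map, List.mem_flatMap] at h
  obtain ⟨_, ⟨s, hs, c, hc, rfl⟩, rfl⟩ := h
  have h1 : ∀ s ∈ seed, isTile s.2.1 = true ∧ s.1 = 1 := by decide
  have h2 := chain_tile (h1 s hs).1 _ c hc
  simp [h2, h1 s hs, act]

/-- The hats of the `m`-th patch. -/
def patchSet (m : ℕ) : Set Cell := {c | ∃ i : ℕ, ∃ t ∈ chain (2 * m) .F,
  c = act (top m * ev (2 * m) (gen ^ i)) t.2}

theorem gen_pow_three : gen ^ 3 = 1 := by decide +kernel

theorem mem_patchSet {m : ℕ} {c : Cell} : c ∈ patchSet m ↔ (1, c) ∈ patch m := by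
  constructor
  · rintro ⟨i, t, ht, rfl⟩
    simp only [patch, realize, List.mem_map, List.mem_flatMap]
    refine ⟨(1, act (ev (2 * m) (gen ^ i)) t.2), ⟨(1, .F, gen ^ i), ?_, t, ht, ?_⟩, ?_⟩
    · rw [← pow_mod_orderOf, orderOf_eq_prime gen_pow_three (by decide +kernel)]
      have := Nat.mod_lt i (show 0 < 3 by norm_num)
      interval_cases i % 3 <;> decide +kernel
    · rw [(chain_tile rfl _ t ht).1]; rfl
    · rw [act_mul]; rfl
  · intro h
    simp only [patch, realize, List.mem_map, List.mem_flatMap] at h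
    obtain ⟨_, ⟨s, hs, t, ht, rfl⟩, he⟩ := h
    obtain rfl := congrArg Prod.snd he
    have : ∀ s ∈ seed, s.2.1 = .F ∧ ∃ i < 3, s.2.2 = gen ^ i := by decide +kernel
    obtain ⟨h1, i, -, h2⟩ := this s hs
    rw [h1] at ht
    exact ⟨i, t, ht, by rw [act_mul, h2]⟩

theorem gen_hook (i : ℕ) : hook⁻¹ * sh (sh gen) ^ i * hook = gen ^ i := by
  have h : hook⁻¹ * sh (sh gen) * hook = gen := by decide +kernel
  have := conj_pow (i := i) (a := hook⁻¹) (b := sh (sh gen))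
  rw [inv_inv, h] at this
  exact this.symm

theorem ev_add_two (m : ℕ) (g : FMot) : ev (2 * (m + 1)) g = ev (2 * m) (sh (sh g)) := rfl

theorem patchSet_succ (m : ℕ) : patchSet m ⊆ patchSet (m + 1) := by
  rintro c ⟨i, t, ht, rfl⟩
  refine ⟨i, (1 * (1 * t.1), act (ev (2 * m) hook) t.2), ?_, ?_⟩
  · rw [mul_add, mul_one]
    simp only [chain, List.mem_flatMap, List.mem_map]
    refine ⟨(1, .F, mo 2 1 (-1) 5 2), by decide, (1 * t.1, act (ev (2 * m) (mo 5 1 1 (-1) 0)) t.2),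
      ⟨(1, .F, mo 5 1 1 (-1) 0), by decide, t, ht, rfl⟩, ?_⟩
    rw [← act_mul, ev_succ, ← map_mul]; rfl
  · have e : ev (2 * m) (gen ^ i) =
        (ev (2 * m) hook)⁻¹ * ev (2 * m) (sh (sh (gen ^ i))) * ev (2 * m) hook := by
      rw [← map_inv, ← map_mul, ← map_mul, map_pow sh, map_pow sh, gen_hook]
    rw [← act_mul, top, ev_add_two, e]
    simp only [mul_assoc]

theorem patchSet_mono : Monotone patchSet := monotone_nat_of_le_succ patchSet_succ

/-- The hats of the tiling. -/
def tiles : Set Cell := ⋃ m, patchSet m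

theorem tiles_tag {c : Cell} (h : c ∈ tiles) : c.2 < 2 := by
  obtain ⟨m, hm⟩ := Set.mem_iUnion.1 h
  exact (mem_patch (mem_patchSet.1 hm)).2

/-- The rotation of order three of the tiling. -/
def rho : Mot E := ev 0 gen

theorem rho_top (m : ℕ) : rho * top m = top m * ev (2 * m) gen := by
  induction m with
  | zero => simp [top, rho]
  | succ m ih =>
    have : gen * hook⁻¹ = hook⁻¹ * sh (sh gen) := by decide +kernel
    rw [top, ← mul_assoc, ih, ev_add_two, mul_assoc, mul_assoc, ← map_inv, ← map_mul, ← map_mul,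
      this]

theorem act_rho {c : Cell} (h : c ∈ tiles) : act rho c ∈ tiles := by
  obtain ⟨m, i, t, ht, rfl⟩ := Set.mem_iUnion.1 h
  refine Set.mem_iUnion.2 ⟨m, i + 1, t, ht, ?_⟩
  rw [← act_mul, ← mul_assoc, rho_top, mul_assoc, ← map_mul, pow_succ']

theorem sum_ge_two {ι : Type} [DecidableEq ι] (f : ι → ℤ) (L : List ι) (hf : ∀ x ∈ L, 0 ≤ f x)
    {a b : ι} (ha : a ∈ L) (hb : b ∈ L) (hab : a ≠ b) (ha1 : 1 ≤ f a) (hb1 : 1 ≤ f b) :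
    2 ≤ (L.map f).sum := by
  have hb' : b ∈ L.erase a := (List.mem_erase_of_ne hab.symm).2 hb
  have e := (((List.perm_cons_erase ha).trans ((List.perm_cons_erase hb').cons a)).map f).sum_eq
  rw [e]
  have : 0 ≤ (((L.erase a).erase b).map f).sum := List.sum_nonneg fun x hx => by
    obtain ⟨y, hy, rfl⟩ := List.mem_map.1 hx
    exact hf y (List.mem_of_mem_erase (List.mem_of_mem_erase hy))
  simp only [List.map_cons, List.sum_cons]
  linarith

theorem hsum_ind_nonneg (κ : Mot E) (c : Cell) : 0 ≤ hsum (ind κ) c := by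
  refine List.sum_nonneg fun x hx => ?_
  obtain ⟨y, -, rfl⟩ := List.mem_map.1 hx
  unfold ind; split <;> norm_num

theorem one_le_hsum_ind {κ : Mot E} {c : Cell} (h : κ ∈ kites c) : 1 ≤ hsum (ind κ) c := by
  have : ind κ κ ≤ hsum (ind κ) c := by
    refine List.single_le_sum (fun x hx => ?_) _ (List.mem_map_of_mem h)
    obtain ⟨y, -, rfl⟩ := List.mem_map.1 hx
    unfold ind; split <;> norm_num
  simpa [ind] using this

/-- Each kite belongs to exactly one hat of the tiling. -/
theorem existsUnique_tile (κ : Mot E) : ∃! c, c ∈ tiles ∧ κ ∈ kites c := by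
  obtain ⟨M, hM⟩ := Filter.eventually_atTop.1 (patch_kite κ)
  refine existsUnique_of_exists_of_unique ?_ fun c c' ⟨hc, hκ⟩ ⟨hc', hκ'⟩ => ?_
  · by_contra! h
    have := hM M le_rfl
    rw [val_eq_zero] at this
    · norm_num at this
    · intro t ht
      refine List.sum_eq_zero fun x hx => ?_
      obtain ⟨y, hy, rfl⟩ := List.mem_map.1 hx
      refine if_neg ?_
      rintro rfl
      refine h t.2 (Set.mem_iUnion.2 ⟨M, mem_patchSet.2 ?_⟩) hy
      rwa [← (mem_patch ht).1]
  · obtain ⟨m, hm⟩ := Set.mem_iUnion.1 hc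
    obtain ⟨m', hm'⟩ := Set.mem_iUnion.1 hc'
    set k := max M (max m m')
    have h1 := mem_patchSet.1 (patchSet_mono (show m ≤ k by omega) hm)
    have h2 := mem_patchSet.1 (patchSet_mono (show m' ≤ k by omega) hm')
    have h3 := hM k (by omega)
    by_contra hne
    have := sum_ge_two (fun t : CTerm => t.1 * hsum (ind κ) t.2) (patch k) (fun t ht => by
      rw [(mem_patch ht).1, one_mul]; exact hsum_ind_nonneg _ _) h1 h2 (fun e => hne
        (congrArg Prod.snd e)) (by simpa using one_le_hsum_ind hκ)
        (by simpa using one_le_hsum_ind hκ')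
    rw [val] at h3
    linarith

/-! ### The tiling has no translations -/

/-- The symmetries of the combinatorial tiling. -/
def aut : Subgroup (Mot E) where
  carrier := {g | ∀ c, act g c ∈ tiles ↔ c ∈ tiles}
  one_mem' c := by rw [act_one]
  mul_mem' {a b} ha hb c := by rw [act_mul, ha, hb]
  inv_mem' {a} ha c := by rw [← ha, ← act_mul, mul_inv_cancel, act_one]

theorem rho_mem_aut : rho ∈ aut := fun c => by
  refine ⟨fun h => ?_, act_rho⟩
  have := act_rho (act_rho h)
  rwa [← act_mul, ← act_mul, show rho * rho * rho = 1 by decide +kernel, act_one] at this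

open Classical in
/-- The indicator function of the kites of reflected hats. -/
def refl (κ : Mot E) : ℤ := if ∃ c ∈ tiles, c.2 = 1 ∧ κ ∈ kites c then 1 else 0

theorem refl_of_mem {c : Cell} (hc : c ∈ tiles) {κ : Mot E} (hκ : κ ∈ kites c) :
    refl κ = c.2 := by
  have h2 := tiles_tag hc
  unfold refl
  split_ifs with h
  · obtain ⟨c', h1, h3, h4⟩ := h
    rw [(existsUnique_tile κ).unique ⟨hc, hκ⟩ ⟨h1, h4⟩, h3]; rfl
  · have : c.2 ≠ 1 := fun h1 => h ⟨c, hc, h1, hκ⟩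
    have : c.2 = 0 := by omega
    simp [this]

theorem refl_mul {g : Mot E} (hg : g ∈ aut) (κ : Mot E) : refl (g * κ) = refl κ := by
  obtain ⟨c, ⟨hc, hκ⟩, -⟩ := existsUnique_tile κ
  rw [refl_of_mem hc hκ, refl_of_mem ((hg c).2 hc) (κ := g * κ)]
  · rfl
  · rw [kites_act]; exact List.mem_map_of_mem hκ

theorem abs_refl_le (κ : Mot E) : |refl κ| ≤ 1 := by
  unfold refl; split_ifs <;> simp

/-- Divergences of bounded flows. -/
def IsBdry (f : Mot E → ℤ) : Prop :=
  ∃ φ, IsFlow φ ∧ (∃ B, ∀ c, |φ c| ≤ B) ∧ ∀ κ, f κ = dvg φ κ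

theorem IsBdry.zero : IsBdry fun _ => 0 :=
  ⟨fun _ => 0, fun _ _ => by simp, ⟨0, by simp⟩, fun _ => by simp [dvg]⟩

theorem IsBdry.sub {f g : Mot E → ℤ} (hf : IsBdry f) (hg : IsBdry g) :
    IsBdry fun κ => f κ - g κ := by
  obtain ⟨φ, h1, ⟨B, hB⟩, h2⟩ := hf
  obtain ⟨χ, h3, ⟨D, hD⟩, h4⟩ := hg
  refine ⟨fun c => φ c - χ c, fun c hc => ?_, ⟨B + D, fun c => ?_⟩, fun κ => ?_⟩
  · simp only [h1 c hc, h3 c hc]; ring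
  · exact (abs_sub _ _).trans (add_le_add (hB c) (hD c))
  · simp only [dvg_sub, h2, h4]

theorem IsBdry.neg {f : Mot E → ℤ} (hf : IsBdry f) : IsBdry fun κ => -f κ := by
  simpa using IsBdry.zero.sub hf

theorem IsBdry.add {f g : Mot E → ℤ} (hf : IsBdry f) (hg : IsBdry g) :
    IsBdry fun κ => f κ + g κ := by
  simpa using hf.sub hg.neg

theorem IsBdry.sum {ι : Type} (s : Finset ι) (f : ι → Mot E → ℤ) (h : ∀ i, IsBdry (f i)) :
    IsBdry fun κ => ∑ i ∈ s, f i κ := by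
  classical
  induction s using Finset.induction_on with
  | empty => simpa using IsBdry.zero
  | insert a s ha ih => simpa [Finset.sum_insert ha] using (h a).add ih

theorem isBdry_side (R : Mot E → ℤ) {B : ℤ} (hR : ∀ κ, |R κ| ≤ B) {s : ℕ} (hs : s < 4) :
    IsBdry fun κ => R (κ * side s) - R κ := by
  have hB : 0 ≤ B := (abs_nonneg _).trans (hR 1)
  refine ⟨fun c => (if c.2 = s then R (c.1 * side s) else 0) -
    (if c.2 = opp s then R c.1 else 0), fun c hc => ?_, ⟨B + B, fun c => ?_⟩, fun κ => ?_⟩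
  · have h1 : opp c.2 = s ↔ c.2 = opp s :=
      ⟨fun h => by rw [← h, opp_opp], fun h => by rw [h, opp_opp]⟩
    have h2 : opp c.2 = opp s ↔ c.2 = s :=
      ⟨fun h => by rw [← opp_opp c.2, h, opp_opp], fun h => by rw [h]⟩
    simp only [rev, h1, h2]
    have e : c.2 = opp s → side c.2 * side s = 1 := fun h => by
      have := side_opp (opp s)
      rwa [opp_opp, ← h] at this
    split_ifs with h3 h4 h4
    · rw [mul_assoc, e h3, h4]; simp
    · rw [mul_assoc, e h3]; simp
    · rw [h4]; simp
    · simp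
  · refine (abs_sub _ _).trans (add_le_add ?_ ?_) <;> split_ifs <;> simp [hR, hB]
  · interval_cases s <;> simp [dvg, opp] <;> ring

theorem isBdry_mul (g : Mot E) : ∀ R : Mot E → ℤ, (∃ B, ∀ κ, |R κ| ≤ B) →
    IsBdry fun κ => R (κ * g) - R κ := by
  let G : Subgroup (Mot E) :=
    { carrier := {g | ∀ R : Mot E → ℤ, (∃ B, ∀ κ, |R κ| ≤ B) →
        IsBdry fun κ => R (κ * g) - R κ}
      one_mem' := fun R _ => by simpa using IsBdry.zero
      mul_mem' := fun {a b} ha hb R ⟨B, hB⟩ => by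
        have h1 := ha (fun κ => R (κ * b)) ⟨B, fun κ => hB _⟩
        have h2 := hb R ⟨B, hB⟩
        simpa [mul_assoc] using h1.add h2
      inv_mem' := fun {a} ha R ⟨B, hB⟩ => by
        have h1 := ha (fun κ => R (κ * a⁻¹)) ⟨B, fun κ => hB _⟩
        simpa using h1.neg }
  have hG := eq_top_of_sides G fun s hs R ⟨B, hB⟩ => isBdry_side R hB hs
  exact show g ∈ G from hG ▸ Subgroup.mem_top _

theorem isBdry_of_finiteIndex (h : aut.FiniteIndex) :
    ∃ α S : ℤ, 0 < α ∧ IsBdry fun κ => α * refl κ - S := by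
  let N := aut.normalCore
  have : Fintype (Mot E ⧸ N) := Fintype.ofFinite _
  have hN : ∀ κ n, n ∈ N → refl (κ * n) = refl κ := fun κ n hn => by
    have := (inferInstance : N.Normal).conj_mem n hn κ
    rw [← refl_mul (Subgroup.normalCore_le aut this) κ]
    simp
  let f : Mot E ⧸ N → ℤ := Quotient.lift refl fun a b hab => by
    have := hN a _ (QuotientGroup.leftRel_apply.1 hab)
    rw [mul_inv_cancel_left] at this
    exact this.symm
  have hf : ∀ κ : Mot E, f (κ : Mot E ⧸ N) = refl κ := fun κ => rfl
  refine ⟨Fintype.card (Mot E ⧸ N), ∑ q, f q, by exact_mod_cast Fintype.card_pos, ?_⟩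
  have h1 := (IsBdry.sum Finset.univ (fun (q : Mot E ⧸ N) (κ : Mot E) => refl (κ * q.out) - refl κ)
    fun q => isBdry_mul q.out refl ⟨1, abs_refl_le⟩).neg
  convert h1 using 2 with κ
  have h2 : ∑ q : Mot E ⧸ N, refl (κ * q.out) = ∑ q, f q := by
    rw [← Equiv.sum_comp (Equiv.mulLeft (κ : Mot E ⧸ N)) f]
    refine Finset.sum_congr rfl fun q _ => ?_
    rw [← hf]
    congr 1
    simp
  rw [Finset.sum_sub_distrib, h2]
  simp

theorem finiteIndex_of_translation {v : E} (hv : v ≠ 0) (h : (⟨0, v⟩ : Mot E) ∈ aut) :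
    aut.FiniteIndex := by
  let T : AddSubgroup E :=
    { carrier := {x | (⟨0, x * v⟩ : Mot E) ∈ aut}
      zero_mem' := by
        change (⟨0, 0 * v⟩ : Mot E) ∈ aut
        rw [zero_mul]; exact aut.one_mem
      add_mem' := fun {x y} hx hy => by
        have := aut.mul_mem hx hy
        change (⟨0, (x + y) * v⟩ : Mot E) ∈ aut
        convert this using 1
        ext1 <;> simp [Mot.mul_k, Mot.mul_x, rt_zero, add_mul]
      neg_mem' := fun {x} hx => by
        have := aut.inv_mem hx
        change (⟨0, -x * v⟩ : Mot E) ∈ aut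
        convert this using 1
        ext1 <;> simp [Mot.inv_k, Mot.inv_x, rt_zero] }
  have h1 : (1 : E) ∈ T := by
    change (⟨0, 1 * v⟩ : Mot E) ∈ aut
    rwa [one_mul]
  have h2 : (⟨0, 1⟩ : E) ∈ T := by
    have := aut.mul_mem (aut.mul_mem rho_mem_aut h) (aut.inv_mem rho_mem_aut)
    change (⟨0, ⟨0, 1⟩ * v⟩ : Mot E) ∈ aut
    convert this using 1
    ext1
    · simp [Mot.mul_k, Mot.inv_k]
    · have e : rt 2 = ⟨0, 1⟩ := rfl
      have e' : rho.k = 2 := rfl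
      simp only [Mot.mul_k, Mot.mul_x, Mot.inv_x, smul_neg, smul_smul, ← rt_add, e']
      simp [e, rt_zero]
  have hT : ∀ x, x ∈ T := fun x => by
    have := T.add_mem (T.zsmul_mem h1 x.re) (T.zsmul_mem h2 x.im)
    convert this using 1
    ext <;> simp
  set n : ℤ := v.re ^ 2 - v.re * v.im + v.im ^ 2 with hn
  have hn0 : n ≠ 0 := fun h0 => hv <| by
    have h3 : v.im = 0 := by nlinarith [sq_nonneg (2 * v.re - v.im), sq_nonneg v.im]
    have h4 : v.re = 0 := by simpa [hn, h3] using h0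
    ext <;> simp [h3, h4]
  have hmem : ∀ a b : ℤ, (⟨0, ⟨n * a, n * b⟩⟩ : Mot E) ∈ aut := fun a b => by
    have := hT (⟨a, b⟩ * ⟨v.re - v.im, -v.im⟩)
    change (⟨0, ⟨a, b⟩ * ⟨v.re - v.im, -v.im⟩ * v⟩ : Mot E) ∈ aut at this
    convert this using 2
    ext <;> simp [hn] <;> ring
  have : NeZero n.natAbs := ⟨by simpa using hn0⟩
  let f : Mot E → ZMod 6 × ZMod n.natAbs × ZMod n.natAbs := fun g => (g.k, g.x.re, g.x.im)
  have : Finite (Mot E ⧸ aut) := by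
    refine Finite.of_injective (fun q : Mot E ⧸ aut => f q.out) fun p q hpq => ?_
    rw [← QuotientGroup.out_eq' p, ← QuotientGroup.out_eq' q, QuotientGroup.eq]
    simp only [f, Prod.mk.injEq, ZMod.intCast_eq_intCast_iff_dvd_sub, Int.natCast_natAbs,
      abs_dvd] at hpq
    obtain ⟨h3, ⟨a, ha⟩, ⟨b, hb⟩⟩ := hpq
    let w : E := rt (-p.out.k) * ⟨a, b⟩
    convert hmem w.re w.im using 1
    ext1
    · simp [Mot.mul_k, Mot.inv_k, h3]
    · have e : q.out.x = p.out.x + (n : E) * ⟨a, b⟩ := by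
        ext
        · simp; linarith
        · simp; linarith
      have e' : (⟨n * w.re, n * w.im⟩ : E) = (n : E) * w := by ext <;> simp
      rw [Mot.mul_x, Mot.inv_x, Mot.inv_k, e, e']
      simp only [smul_eq_mul, w]
      ring
  exact Subgroup.finiteIndex_of_finite_quotient

theorem abs_val_chain_le {B : ℤ} (n : ℕ) (X : Symb) (hX : isTile X = false) (φ : Cell → ℤ)
    (hφ : ∀ c, |φ c| ≤ B) : |val φ (chain n X)| ≤ 6 * 4 ^ n * B := by
  have hB : 0 ≤ B := (abs_nonneg _).trans (hφ (1, 0))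
  have key : ∀ {ι : Type} (L : List ι) (f : ι → ℤ) (D : ℤ), (∀ x ∈ L, |f x| ≤ D) →
      |(L.map f).sum| ≤ L.length * D := by
    intro ι L f D h
    induction L with
    | nil => simp
    | cons x L ih =>
      have h1 := ih fun y hy => h y (List.mem_cons_of_mem _ hy)
      have h2 := h x List.mem_cons_self
      have h3 := abs_add_le (f x) (L.map f).sum
      simp only [List.map_cons, List.sum_cons, List.length_cons]
      push_cast
      linarith
  induction n generalizing X φ with
  | zero =>
    have h : ∀ X, isTile X = false → (base X).length ≤ 6 ∧ ∀ c ∈ base X, |c.1| ≤ 1 := by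
      intro X; cases X <;> decide +kernel
    have h1 := key (base X) (fun c => c.1 * φ c.2) B fun c hc => by
      rw [abs_mul]
      exact (mul_le_mul ((h X hX).2 c hc) (hφ _) (abs_nonneg _) (by norm_num)).trans_eq
        (one_mul _)
    have h2 : ((base X).length : ℤ) * B ≤ 6 * B :=
      mul_le_mul_of_nonneg_right (by exact_mod_cast (h X hX).1) hB
    simp only [pow_zero, mul_one]
    exact h1.trans h2
  | succ n ih =>
    have h : ∀ X, isTile X = false → (sub X).length ≤ 4 ∧
        ∀ t ∈ sub X, |t.1| ≤ 1 ∧ isTile t.2.1 = false := by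
      intro X; cases X <;> decide +kernel
    rw [val_chain_succ]
    have h1 := key (sub X) (fun t => t.1 * val (fun c => φ (act (ev n t.2.2) c))
      (chain n t.2.1)) (6 * 4 ^ n * B) fun t ht => by
        rw [abs_mul]
        exact (mul_le_mul ((h X hX).2 t ht).1 (ih _ ((h X hX).2 t ht).2 _ fun c => hφ _)
          (abs_nonneg _) (by norm_num)).trans_eq (one_mul _)
    have h2 : ((sub X).length : ℤ) * (6 * 4 ^ n * B) ≤ 4 * (6 * 4 ^ n * B) :=
      mul_le_mul_of_nonneg_right (by exact_mod_cast (h X hX).1) (by positivity)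
    refine (h1.trans h2).trans_eq ?_
    rw [pow_succ]; ring

/-- The weighted number of hats of a tile. -/
def weight (α S : ℤ) (n : ℕ) (X : Symb) : ℤ := val (fun c => α * c.2 - S) (chain n X)

theorem weight_bound {α S : ℤ} (h : IsBdry fun κ => α * refl κ - S) :
    ∃ C, ∀ m, |weight α S (2 * m) .F| ≤ C * 16 ^ m := by
  obtain ⟨φ, h1, ⟨B, hB⟩, h2⟩ := h
  refine ⟨9 * 6 * B, fun m => ?_⟩
  have h3 := val_dvg_chain (h1.act (top m)) (2 * m) .F rfl
  have h4 : val (hsum (dvg fun c => φ (act (top m) c))) (chain (2 * m) .F) =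
      8 * weight α S (2 * m) .F := by
    simp only [weight, val, ← List.sum_map_mul_left]
    congr 1
    refine List.map_congr_left fun t ht => ?_
    rw [← hsum_dvg_act]
    have h5 : act (top m) t.2 ∈ tiles := Set.mem_iUnion.2 ⟨m, 0, t, ht, by simp⟩
    have h6 : ∀ κ ∈ kites (act (top m) t.2), dvg φ κ = α * t.2.2 - S := fun κ hκ => by
      rw [← h2]
      exact congrArg (fun r => α * r - S) (refl_of_mem h5 hκ)
    have h7 : hsum (dvg φ) (act (top m) t.2) = 8 * (α * t.2.2 - S) := by
      rw [hsum, List.map_congr_left h6, List.map_const', List.sum_replicate, kites,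
        List.length_map]
      have : ∀ s, (hatKites s).length = 8
        | 0 => rfl
        | _ + 1 => rfl
      rw [this]; simp
    rw [h7]; ring
  have h5 : |fval (2 * m) (fun c => φ (act (top m) c)) (bd .F)| ≤ 9 * (6 * 4 ^ (2 * m) * B) := by
    have h6 : ∀ (g : FMot) (X : Symb), isTile X = false →
        |val (fun c => φ (act (top m) (act (ev (2 * m) g) c))) (chain (2 * m) X)| ≤
          6 * 4 ^ (2 * m) * B := fun g X hX => abs_val_chain_le _ X hX _ fun c => hB _
    simp only [fval, bd, List.map_cons, List.map_nil, List.sum_cons, List.sum_nil]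
    simp only [abs_le] at h6 ⊢
    have i1 := h6 (mo 1 (-3) (-2) (-2) (-1)) .d rfl
    have i2 := h6 (mo 4 0 (-2) (-2) (-2)) .a rfl
    have i3 := h6 (mo 2 0 (-1) 1 1) .a rfl
    have i4 := h6 (mo 2 (-2) (-4) 0 (-2)) .d rfl
    have i5 := h6 (mo 5 1 (-1) 1 (-2)) .a rfl
    have i6 := h6 (mo 0 0 0 0 0) .e rfl
    have i7 := h6 (mo 4 3 0 4 3) .e rfl
    have i8 := h6 (mo 5 2 (-1) 1 (-1)) .a rfl
    have i9 := h6 (mo 1 0 (-1) 1 1) .b rfl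
    constructor <;> linarith
  rw [← h3, h4, pow_mul, abs_mul] at h5
  norm_num at h5
  have := abs_nonneg (weight α S (2 * m) .F)
  linarith

theorem weight_succ (α S : ℤ) (n : ℕ) (X : Symb) :
    weight α S (n + 1) X = ((sub X).map fun t => t.1 * weight α S n t.2.1).sum := by
  rw [weight, val_chain_succ]; rfl

/-- An integer sequence with `u (m+2) = 47 u (m+1) - u m` which grows slowly vanishes. -/
theorem eq_zero_of_slow (u : ℕ → ℤ) (hu : ∀ m, u (m + 2) = 47 * u (m + 1) - u m) (C : ℤ)
    (hC : ∀ m, |u m| ≤ C * 16 ^ m) : u 0 = 0 ∧ u 1 = 0 := by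
  have h1 : ∀ m, |u (m + 1)| ≤ |u m| := fun m => by
    by_contra! h
    have h2 : ∀ k, 32 ^ k ≤ |u (m + k + 1)| ∧ |u (m + k)| < |u (m + k + 1)| := fun k => by
      induction k with
      | zero =>
        have := abs_nonneg (u m)
        exact ⟨by simp only [pow_zero, add_zero]; omega, h⟩
      | succ k ih =>
        have e : u (m + (k + 1) + 1) = 47 * u (m + k + 1) - u (m + k) := hu (m + k)
        have e' : m + (k + 1) = m + k + 1 := rfl
        have h3 : 47 * |u (m + k + 1)| ≤ |u (m + (k + 1) + 1)| + |u (m + k)| := by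
          have := abs_add_le (u (m + (k + 1) + 1)) (u (m + k))
          rw [e, sub_add_cancel, abs_mul] at this
          rw [e]
          have h4 : |(47 : ℤ)| = 47 := rfl
          rwa [h4] at this
        have h4 := abs_nonneg (u (m + k))
        rw [e'] at h3 ⊢
        rw [pow_succ]
        constructor <;> linarith [ih.1, ih.2]
    have h5 : ∀ k : ℕ, (2 : ℤ) ^ k ≤ C * 16 ^ (m + 1) := fun k => by
      have h6 := (h2 k).1.trans (hC _)
      have e : C * 16 ^ (m + k + 1) = C * 16 ^ (m + 1) * 16 ^ k := by ring
      rw [e, show (32 : ℤ) = 2 * 16 by norm_num, mul_pow] at h6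
      exact le_of_mul_le_mul_right h6 (by positivity)
    have h6 := h5 (C * 16 ^ (m + 1)).toNat
    have h7 : (((C * 16 ^ (m + 1)).toNat : ℕ) : ℤ) < 2 ^ (C * 16 ^ (m + 1)).toNat := by
      exact_mod_cast Nat.lt_two_pow_self
    have h8 := Int.self_le_toNat (C * 16 ^ (m + 1))
    linarith
  have h2 : ∀ m, 2 * |u (m + 1)| ≤ |u m| := fun m => by
    have h3 := abs_add_le (u (m + 2)) (u m)
    rw [hu, sub_add_cancel, abs_mul, ← hu] at h3
    have h4 := h1 (m + 1)
    have h5 : |(47 : ℤ)| = 47 := rfl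
    rw [h5] at h3
    have := abs_nonneg (u (m + 1))
    have e : m + 1 + 1 = m + 2 := rfl
    rw [e] at h4
    linarith
  have h3 : ∀ m, 2 ^ m * |u m| ≤ |u 0| := fun m => by
    induction m with
    | zero => simp
    | succ m ih =>
      have := mul_le_mul_of_nonneg_left (h2 m) (show (0 : ℤ) ≤ 2 ^ m by positivity)
      rw [pow_succ]
      linarith
  have h4 : ∃ m, u m = 0 := by
    refine ⟨|u 0|.toNat, ?_⟩
    by_contra h
    have h5 : 1 ≤ |u |u 0|.toNat| := Int.one_le_abs h
    have h6 := h3 |u 0|.toNat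
    have h7 : ((|u 0|.toNat : ℕ) : ℤ) < 2 ^ |u 0|.toNat := by
      exact_mod_cast Nat.lt_two_pow_self
    have h8 := Int.self_le_toNat |u 0|
    nlinarith
  obtain ⟨m, hm⟩ := h4
  have h5 : u (m + 1) = 0 := by
    have := h1 m
    rw [hm] at this
    simpa using this
  induction m with
  | zero => exact ⟨hm, h5⟩
  | succ m ih =>
    have := hu m
    exact ih (by linarith) hm

theorem not_finiteIndex : ¬ aut.FiniteIndex := fun h => by
  obtain ⟨α, S, hα, hb⟩ := isBdry_of_finiteIndex h
  obtain ⟨C, hC⟩ := weight_bound hb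
  let u : ℕ → ℤ := fun m => weight α S (2 * m + 2) .F - weight α S (2 * m) .F
  have hs := weight_succ α S
  have hH : ∀ n, weight α S (n + 1) .H = 3 * weight α S n .H + weight α S n .T +
      3 * weight α S n .P + 3 * weight α S n .F := fun n => by
    rw [hs]; simp [sub]; ring
  have hT : ∀ n, weight α S (n + 1) .T = weight α S n .H := fun n => by
    rw [hs]; simp [sub]
  have hP : ∀ n, weight α S (n + 1) .P = weight α S n .P + 2 * weight α S n .H +
      2 * weight α S n .F := fun n => by
    rw [hs]; simp [sub]; ring
  have hF : ∀ n, weight α S (n + 1) .F = weight α S n .P + 2 * weight α S n .H +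
      3 * weight α S n .F := fun n => by
    rw [hs]; simp [sub]; ring
  have hR : ∀ n, weight α S (n + 4) .F = 7 * weight α S (n + 3) .F -
      7 * weight α S (n + 1) .F + weight α S n .F := fun n => by
    rw [hF (n + 3), hH (n + 2), hP (n + 2), hF (n + 2), hH (n + 1), hT (n + 1), hP (n + 1),
      hF (n + 1), hH n, hT n, hP n, hF n]
    ring
  have h0 := eq_zero_of_slow u (fun m => ?_) (C * 17) fun m => ?_
  · have bH : weight α S 0 .H = α - 4 * S := by simp [weight, val, chain, base, ce]; ring
    have bT : weight α S 0 .T = - S := by simp [weight, val, chain, base, ce]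
    have bP : weight α S 0 .P = -2 * S := by simp [weight, val, chain, base, ce]; ring
    have bF : weight α S 0 .F = -2 * S := by simp [weight, val, chain, base, ce]; ring
    obtain ⟨h1, h2⟩ := h0
    simp only [u, mul_zero, zero_add, mul_one] at h1 h2
    norm_num at h1 h2
    have := hH 0; have := hT 0; have := hP 0; have := hF 0
    have := hH 1; have := hT 1; have := hP 1; have := hF 1
    have := hH 2; have := hT 2; have := hP 2; have := hF 2
    have := hF 3
    norm_num at *
    omega
  · have e := hR (2 * m + 2)
    have e' := hR (2 * m + 1)
    have e'' := hR (2 * m)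
    simp only [add_assoc, Nat.reduceAdd] at e e' e''
    simp only [u, mul_add, mul_one, add_assoc, Nat.reduceAdd, Nat.reduceMul]
    linarith
  · have h1 := hC m
    have h2 := hC (m + 1)
    have h3 := abs_sub (weight α S (2 * m + 2) .F) (weight α S (2 * m) .F)
    have e : 2 * (m + 1) = 2 * m + 2 := by ring
    rw [e, pow_succ] at h2
    linarith

/-- The tiling has no translations. -/
theorem eq_zero_of_translation {v : E} (h : (⟨0, v⟩ : Mot E) ∈ aut) : v = 0 := by
  by_contra hv
  exact not_finiteIndex (finiteIndex_of_translation hv h)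

/-- Conjugation of motions by the reflection in the real axis. -/
def cnj : Mot E →* Mot E where
  toFun g := ⟨-g.k, ⟨-g.x.im, -g.x.re⟩⟩
  map_one' := rfl
  map_mul' g h := by
    obtain ⟨k, x⟩ := g
    obtain ⟨l, y⟩ := h
    have h : ∀ k : ZMod 6, (rt (-k)).re = (rt k).re - (rt k).im ∧ (rt (-k)).im = -(rt k).im := by
      decide
    ext
    · simp only [Mot.mul_k]; ring
    · simp [Mot.mul_x, h]; ring
    · simp [Mot.mul_x, h]; ring

theorem cnj_k (g : Mot E) : (cnj g).k = -g.k := rfl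

theorem cnj_x (g : Mot E) : (cnj g).x = ⟨-g.x.im, -g.x.re⟩ := rfl

theorem cnj_cnj (g : Mot E) : cnj (cnj g) = g := by
  ext <;> simp [cnj_k, cnj_x]

/-- `g` followed by the reflection in the real axis is an anti-automorphism of the tiling. -/
def Flips (g : Mot E) : Prop :=
  ∀ (k : Mot E) (s : ℕ), s < 2 → ((g * cnj k, 1 - s) ∈ tiles ↔ (k, s) ∈ tiles)

theorem kites_flip (g k : Mot E) {s : ℕ} (hs : s < 2) :
    kites (g * cnj k, 1 - s) = (kites (k, s)).map fun κ => g * cnj κ := by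
  have h : hatKites (1 - s) = (hatKites s).map cnj := by
    interval_cases s <;> decide
  simp [kites, h, mul_assoc]

theorem Flips.refl {g : Mot E} (hg : Flips g) (κ : Mot E) :
    HatC.refl (g * cnj κ) = 1 - HatC.refl κ := by
  obtain ⟨⟨k, s⟩, ⟨hc, hκ⟩, -⟩ := existsUnique_tile κ
  have hs : s < 2 := tiles_tag hc
  rw [refl_of_mem hc hκ, refl_of_mem ((hg k s hs).2 hc)]
  · show ((1 - s : ℕ) : ℤ) = 1 - (s : ℤ)
    omega
  · rw [kites_flip g k hs]
    exact List.mem_map_of_mem (f := fun κ => g * cnj κ) hκ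

theorem Flips.conj_mem_aut {g : Mot E} (hg : Flips g) {a : Mot E} (ha : a ∈ aut) :
    g * cnj a * g⁻¹ ∈ aut := fun ⟨k, s⟩ => by
  by_cases hs : s < 2
  · have h1 := hg (cnj (g⁻¹ * k)) (1 - s) (by omega)
    have h2 := hg (a * cnj (g⁻¹ * k)) (1 - s) (by omega)
    have h3 := ha (cnj (g⁻¹ * k), 1 - s)
    have e : 1 - (1 - s) = s := by omega
    simp only [act, map_mul, cnj_cnj, e, mul_inv_cancel_left, mul_assoc] at h1 h2 h3 ⊢
    rw [h1, ← h3, ← h2]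
  · exact ⟨fun h => absurd (tiles_tag h) hs, fun h => absurd (tiles_tag h) hs⟩

theorem eq_one_of_mem_aut {g : Mot E} (h : g ∈ aut) (hk : g.k = 0) : g = 1 := by
  obtain ⟨k, x⟩ := g
  obtain rfl : k = 0 := hk
  rw [eq_zero_of_translation h]; rfl

theorem rho_eq : rho = ⟨2, ⟨3, -1⟩⟩ := by decide +kernel

theorem mem_aut_iff {g : Mot E} : g ∈ aut ↔ g = 1 ∨ g = rho ∨ g = rho * rho := by
  refine ⟨fun h => ?_, ?_⟩
  · have h1 := eq_one_of_mem_aut (aut.mul_mem (aut.mul_mem h rho_mem_aut)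
      (aut.inv_mem (aut.mul_mem rho_mem_aut h))) (by simp [Mot.mul_k, Mot.inv_k]; ring)
    rw [mul_inv_eq_one] at h1
    obtain ⟨k, ⟨a, b⟩⟩ := g
    have h2 := congrArg (fun m : Mot E => m.x.re) h1
    have h3 := congrArg (fun m : Mot E => m.x.im) h1
    fin_cases k <;> simp [rho_eq, Mot.mul_x, rt] at h2 h3 <;> first
      | omega
      | (obtain ⟨rfl, rfl⟩ : a = 0 ∧ b = 0 := by omega
         decide +kernel)
      | (obtain ⟨rfl, rfl⟩ : a = 3 ∧ b = -1 := by omega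
         decide +kernel)
      | (obtain ⟨rfl, rfl⟩ : a = 4 ∧ b = 3 := by omega
         decide +kernel)
  · rintro (rfl | rfl | rfl)
    · exact aut.one_mem
    · exact rho_mem_aut
    · exact aut.mul_mem rho_mem_aut rho_mem_aut

theorem not_flips (g : Mot E) : ¬ Flips g := fun hg => by
  have h1 := eq_one_of_mem_aut (aut.mul_mem (hg.conj_mem_aut rho_mem_aut) rho_mem_aut)
    (by simp [Mot.mul_k, Mot.inv_k, cnj_k])
  have h4 : g * cnj rho = ⟨4, ⟨4, 3⟩⟩ * g := by
    rw [← mul_inv_eq_iff_eq_mul, show (⟨4, ⟨4, 3⟩⟩ : Mot E) = rho⁻¹ by decide +kernel]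
    exact mul_eq_one_iff_eq_inv.1 h1
  have h5 : ∃ a ∈ aut, g * cnj kite0 = a * kite0 := by
    have h2 := congrArg (fun m : Mot E => m.x.re) h4
    have h3 := congrArg (fun m : Mot E => m.x.im) h4
    simp only [mem_aut_iff, exists_eq_or_imp, exists_eq_left]
    obtain ⟨k, ⟨a, b⟩⟩ := g
    fin_cases k <;> simp [rho_eq, Mot.mul_x, cnj_x, rt] at h2 h3 <;> first
      | omega
      | (obtain ⟨rfl, rfl⟩ : a = 3 ∧ b = 3 := by omega
         decide +kernel)
      | (obtain ⟨rfl, rfl⟩ : a = 0 ∧ b = -1 := by omega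
         decide +kernel)
      | (obtain ⟨rfl, rfl⟩ : a = 4 ∧ b = 0 := by omega
         decide +kernel)
  obtain ⟨a, ha, h⟩ := h5
  have := hg.refl kite0
  rw [h, refl_mul ha] at this
  omega

/-- The point of the plane with coordinates `(x, y)` with respect to the basis `(3 ± √3 i)`,
up to sign. -/
def pt (x y : ℝ) : ℂ := ⟨3 * (x - y), √3 * (x + y)⟩

theorem exists_pt (z : ℂ) : ∃ x y, z = pt x y := by
  refine ⟨(z.re / 3 + z.im / √3) / 2, (z.im / √3 - z.re / 3) / 2, ?_⟩
  apply Complex.ext <;> simp only [pt]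
  · ring
  · field_simp; ring

theorem pt_inj {x y x' y' : ℝ} : pt x y = pt x' y' ↔ x = x' ∧ y = y' := by
  have h3 : √3 ≠ 0 := by positivity
  simp only [pt, Complex.ext_iff, mul_eq_mul_left_iff, h3]
  constructor
  · rintro ⟨h1, h2⟩
    norm_num at h1 h2
    constructor <;> linarith
  · rintro ⟨rfl, rfl⟩
    simp

theorem dist_pt (x y x' y' : ℝ) : dist (pt x y) (pt x' y') ^ 2 =
    12 * ((x - x') ^ 2 - (x - x') * (y - y') + (y - y') ^ 2) := by
  rw [Complex.dist_eq, Complex.sq_norm, Complex.normSq_apply]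
  simp only [pt, Complex.sub_re, Complex.sub_im]
  have : √3 * √3 = (3 : ℝ) := Real.mul_self_sqrt (by norm_num)
  linear_combination ((x + y) - (x' + y')) ^ 2 * this

theorem toCircle_one : (ZMod.toCircle (1 : ZMod 6) : ℂ) = ⟨1 / 2, √3 / 2⟩ := by
  have h := ZMod.toCircle_intCast (N := 6) 1
  rw [Int.cast_one] at h
  rw [h, show (2 * (Real.pi : ℂ) * I * ((1 : ℤ) : ℂ) / ((6 : ℕ) : ℂ)) = ((Real.pi / 3 : ℝ) : ℂ) * I by
    push_cast; ring, Complex.exp_mul_I, ← Complex.ofReal_cos, ← Complex.ofReal_sin,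
    Real.cos_pi_div_three, Real.sin_pi_div_three]
  apply Complex.ext <;> simp

theorem toCircle_mul_pt (k : ZMod 6) (x y : ℝ) : (ZMod.toCircle k : ℂ) * pt x y =
    pt ((rt k).re * x - (rt k).im * y) ((rt k).im * x + ((rt k).re - (rt k).im) * y) := by
  have h3 : √3 * √3 = (3 : ℝ) := Real.mul_self_sqrt (by norm_num)
  have h1 : ∀ x y, (ZMod.toCircle (1 : ZMod 6) : ℂ) * pt x y = pt (x - y) x := fun x y => by
    rw [toCircle_one]
    apply Complex.ext <;> simp [pt]
    · linear_combination (-(x + y) / 2) * h3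
    · ring
  have h2 : ∀ n : ℕ, (ZMod.toCircle (n : ZMod 6) : ℂ) * pt x y =
      pt ((rt n).re * x - (rt n).im * y) ((rt n).im * x + ((rt n).re - (rt n).im) * y) := fun n => by
    induction n with
    | zero => simp [show rt 0 = ⟨1, 0⟩ from rfl]
    | succ n ih =>
      rw [Nat.cast_succ, add_comm, AddChar.map_add_eq_mul, Circle.coe_mul, mul_assoc, ih, h1, rt_add]
      have h4 : rt 1 = ⟨1, 1⟩ := rfl
      simp [h4]
      congr 1
      ring
  simpa using h2 k.val

theorem pt_add (x y x' y' : ℝ) : pt x y + pt x' y' = pt (x + x') (y + y') := by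
  apply Complex.ext <;> simp [pt] <;> ring

/-- The isometry of the plane given by a motion. -/
def real : Mot E →* IsomC where
  toFun g := (rotation (ZMod.toCircle g.k)).toIsometryEquiv.trans
    (IsometryEquiv.addLeft (pt g.x.re g.x.im))
  map_one' := by
    ext z
    simp [Mot.one_k, Mot.one_x, pt]
    rfl
  map_mul' g h := by
    ext1 z
    obtain ⟨x, y, rfl⟩ := exists_pt z
    simp [Mot.mul_k, Mot.mul_x, rotation_apply, toCircle_mul_pt, pt_add, rt_add,
      IsometryEquiv.mul_apply]
    congr 1 <;> ring

theorem real_apply (g : Mot E) (z : ℂ) :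
    real g z = pt g.x.re g.x.im + (ZMod.toCircle g.k : ℂ) * z := rfl

theorem real_pt (g : Mot E) (x y : ℝ) : real g (pt x y) =
    pt (g.x.re + ((rt g.k).re * x - (rt g.k).im * y))
      (g.x.im + ((rt g.k).im * x + ((rt g.k).re - (rt g.k).im) * y)) := by
  rw [real_apply, toCircle_mul_pt, pt_add]

/-- The reflection in the real axis. -/
def cj : IsomC := conjLIE.toIsometryEquiv

theorem cj_apply (z : ℂ) : cj z = (starRingEnd ℂ) z := rfl

theorem cj_pt (x y : ℝ) : cj (pt x y) = pt (-y) (-x) := by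
  apply Complex.ext <;> simp [pt, cj_apply] <;> ring

theorem cj_mul_cj : cj * cj = 1 := by
  ext1 z; simp [cj_apply, IsometryEquiv.mul_apply]

theorem cj_mul_real (g : Mot E) : cj * real g = real (cnj g) * cj := by
  ext1 z
  obtain ⟨x, y, rfl⟩ := exists_pt z
  have h : ∀ k : ZMod 6, (rt (-k)).re = (rt k).re - (rt k).im ∧ (rt (-k)).im = -(rt k).im := by
    decide
  simp [IsometryEquiv.mul_apply, real_pt, cj_pt, cnj_k, cnj_x, h]
  congr 1 <;> ring

theorem real_injective : Function.Injective real := fun g h e => by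
  have e0 : real g (pt 0 0) = real h (pt 0 0) := by rw [e]
  have e1 : real g (pt 1 0) = real h (pt 1 0) := by rw [e]
  simp only [real_pt, pt_inj] at e0 e1
  obtain ⟨k, ⟨a, b⟩⟩ := g
  obtain ⟨l, ⟨c, d⟩⟩ := h
  simp at e0 e1
  obtain ⟨rfl, rfl⟩ := e0
  simp at e1
  have : ∀ k l : ZMod 6, (rt k).re = (rt l).re ∧ (rt k).im = (rt l).im → k = l := by decide
  rw [this k l e1]

theorem real_ne_real_mul_cj (g h : Mot E) : real g ≠ real h * cj := fun e => by
  have e0 : real (h⁻¹ * g) (pt 0 0) = cj (pt 0 0) := by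
    rw [map_mul, e, map_inv, inv_mul_cancel_left]
  have e1 : real (h⁻¹ * g) (pt 1 0) = cj (pt 1 0) := by
    rw [map_mul, e, map_inv, inv_mul_cancel_left]
  have e2 : real (h⁻¹ * g) (pt 0 1) = cj (pt 0 1) := by
    rw [map_mul, e, map_inv, inv_mul_cancel_left]
  simp only [real_pt, pt_inj, cj_pt] at e0 e1 e2
  generalize h⁻¹ * g = m at *
  obtain ⟨k, ⟨a, b⟩⟩ := m
  simp at e0 e1 e2
  obtain ⟨rfl, rfl⟩ := e0
  simp at e1 e2
  norm_cast at e1 e2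
  revert e1 e2
  revert k
  decide

theorem smul_pt (r x y : ℝ) : r • pt x y = pt (r * x) (r * y) := by
  apply Complex.ext <;> simp [pt] <;> ring

/-- The coordinates of the points of the kite. -/
def InKite (x y : ℝ) : Prop := 0 ≤ x ∧ y ≤ 0 ∧ 2 * x - y ≤ 1 ∧ x - 2 * y ≤ 1

theorem two_eq : (2 : ℂ) = pt (1 / 3) (-1 / 3) := by
  apply Complex.ext <;> simp [pt] <;> norm_num

theorem kite_eq : Kite = convexHull ℝ {pt 0 0, pt (1 / 2) 0, pt (1 / 3) (-1 / 3), pt 0 (-1 / 2)} := by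
  have h0 : (0 : ℂ) = pt 0 0 := by apply Complex.ext <;> simp [pt]
  have h1 : (⟨3 / 2, √3 / 2⟩ : ℂ) = pt (1 / 2) 0 := by
    apply Complex.ext <;> simp [pt] <;> ring
  have h3 : (⟨3 / 2, -(√3 / 2)⟩ : ℂ) = pt 0 (-1 / 2) := by
    apply Complex.ext <;> simp [pt] <;> ring
  rw [Kite, h1, h3, h0, two_eq]

theorem pt_mem_kite {x y : ℝ} : pt x y ∈ Kite ↔ InKite x y := by
  rw [kite_eq]
  constructor
  · intro h
    have hc : Convex ℝ {z : ℂ | ∀ x y, z = pt x y → InKite x y} := by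
      intro z hz w hw a b ha hb hab u v huv
      obtain ⟨x, y, rfl⟩ := exists_pt z
      obtain ⟨x', y', rfl⟩ := exists_pt w
      rw [smul_pt, smul_pt, pt_add, pt_inj] at huv
      obtain ⟨rfl, rfl⟩ := huv
      obtain ⟨h1, h2, h3, h4⟩ := hz x y rfl
      obtain ⟨h5, h6, h7, h8⟩ := hw x' y' rfl
      refine ⟨?_, ?_, ?_, ?_⟩ <;> nlinarith
    refine convexHull_min ?_ hc h x y rfl
    rintro z (rfl | rfl | rfl | rfl) u v h <;> obtain ⟨rfl, rfl⟩ := pt_inj.1 h <;>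
      (unfold InKite; norm_num)
  · rintro ⟨h1, h2, h3, h4⟩
    set S : Set ℂ := {pt 0 0, pt (1 / 2) 0, pt (1 / 3) (-1 / 3), pt 0 (-1 / 2)}
    have hS := convex_convexHull ℝ S
    have h5 : ∀ p ∈ S, p ∈ convexHull ℝ S := fun p hp => subset_convexHull ℝ S hp
    have key : ∀ u v : ℝ, pt u v ∈ S → ∀ a b : ℝ, 0 ≤ a → 0 ≤ b → a + b ≤ 1 →
        pt (a * u + b * (1 / 3)) (a * v + b * (-1 / 3)) ∈ convexHull ℝ S := by
      intro u v huv a b ha hb hab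
      have h6 := hS.sum_mem (t := Finset.univ) (w := ![1 - a - b, a, b])
        (z := ![pt 0 0, pt u v, pt (1 / 3) (-1 / 3)])
        (by intro i _; fin_cases i <;> simp <;> linarith)
        (by simp [Fin.sum_univ_three]; ring)
        (by intro i _; fin_cases i; exacts [h5 _ (by simp [S]), h5 _ huv, h5 _ (by simp [S])])
      simp only [Fin.sum_univ_three, Matrix.cons_val_zero, Matrix.cons_val_one, Matrix.cons_val,
        smul_pt, pt_add] at h6
      convert h6 using 2 <;> ring
    rcases le_total 0 (x + y) with h | h
    · have := key (1 / 2) 0 (by simp [S]) (2 * (x + y)) (-3 * y) (by linarith) (by linarith)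
        (by linarith)
      convert this using 2 <;> ring
    · have := key 0 (-1 / 2) (by simp [S]) (-2 * (x + y)) (3 * x) (by linarith) (by linarith)
        (by linarith)
      convert this using 2 <;> ring

theorem cj_image_kite : cj '' Kite = Kite := by
  have h : ∀ z ∈ Kite, cj z ∈ Kite := fun z hz => by
    obtain ⟨x, y, rfl⟩ := exists_pt z
    rw [cj_pt, pt_mem_kite]
    obtain ⟨h1, h2, h3, h4⟩ := pt_mem_kite.1 hz
    refine ⟨?_, ?_, ?_, ?_⟩ <;> linarith
  refine subset_antisymm (Set.image_subset_iff.2 h) fun z hz => ⟨cj z, h z hz, ?_⟩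
  rw [← IsometryEquiv.mul_apply, cj_mul_cj]; rfl

/-- The isometry given by a decorated motion. -/
def iso (c : Cell) : IsomC := real c.1 * if c.2 = 0 then 1 else cj

theorem exp_pi_div_three : Circle.exp (Real.pi / 3) = ZMod.toCircle (1 : ZMod 6) := by
  ext1
  rw [toCircle_one, Circle.coe_exp, Complex.exp_mul_I, ← Complex.ofReal_cos,
    ← Complex.ofReal_sin, Real.cos_pi_div_three, Real.sin_pi_div_three]
  apply Complex.ext <;> simp

theorem R6_eq : R6 = real ⟨1, 0⟩ := by
  ext1 z
  obtain ⟨x, y, rfl⟩ := exists_pt z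
  simp only [R6, rotAbout, exp_pi_div_three, IsometryEquiv.trans_apply]
  simp [rotation_apply, real_apply, pt]
  rfl

theorem exp_two_pi_div_three : Circle.exp (2 * Real.pi / 3) = ZMod.toCircle (2 : ZMod 6) := by
  rw [show 2 * Real.pi / 3 = Real.pi / 3 + Real.pi / 3 by ring, Circle.exp_add, exp_pi_div_three,
    ← AddChar.map_add_eq_mul]
  rfl

theorem rotAbout_pt (x y u v : ℝ) : rotAbout (2 * Real.pi / 3) (pt u v) (pt x y) =
    pt (u - (y - v)) (v + ((x - u) - (y - v))) := by
  simp only [rotAbout, exp_two_pi_div_three, IsometryEquiv.trans_apply]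
  have h : -pt u v = pt (-u) (-v) := by apply Complex.ext <;> simp [pt] <;> ring
  have h2 : rt 2 = ⟨0, 1⟩ := rfl
  simp [rotation_apply, h, pt_add, toCircle_mul_pt, h2]
  congr 1 <;> ring

theorem R3_eq : R3 = real ⟨2, ⟨0, -1⟩⟩ := by
  ext1 z
  obtain ⟨x, y, rfl⟩ := exists_pt z
  have h3 : rt 2 = ⟨0, 1⟩ := rfl
  rw [R3, two_eq, rotAbout_pt, real_pt]
  simp [h3]
  congr 1 <;> ring

theorem rotAbout_eq_real : rotAbout (2 * Real.pi / 3) (pt (7 / 3) (2 / 3)) = real rho := by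
  ext1 z
  obtain ⟨x, y, rfl⟩ := exists_pt z
  have h3 : rt 2 = ⟨0, 1⟩ := rfl
  rw [rotAbout_pt, rho_eq, real_pt]
  simp [h3]
  congr 1 <;> ring

theorem iso_image_hat {c : Cell} (hc : c.2 < 2) :
    iso c '' Hat = ⋃ κ ∈ kites c, real κ '' Kite := by
  have h0 : Hat = ⋃ κ ∈ hatKites 0, real κ '' Kite := by
    have e1 : R6⁻¹ = real ⟨5, 0⟩ := by rw [R6_eq, ← map_inv]; congr 1
    have e2 : R6⁻¹ * R6⁻¹ = real ⟨4, 0⟩ := by rw [e1, ← map_mul]; congr 1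
    have e3 : R3 * R3 = real ⟨4, ⟨1, 0⟩⟩ := by rw [R3_eq, ← map_mul]; congr 1
    have e4 : R3 * R6⁻¹ = real ⟨1, ⟨0, -1⟩⟩ := by rw [e1, R3_eq, ← map_mul]; congr 1
    have e5 : R3 * R3 * R6⁻¹ = real ⟨3, ⟨1, 0⟩⟩ := by rw [e1, e3, ← map_mul]; congr 1
    have e0 : (1 : IsomC) = real ⟨0, 0⟩ := (map_one real).symm
    rw [Hat, e5, e4, e3, e2, e1, R3_eq, R6_eq, e0]
    simp [hatKites]
  obtain ⟨g, s⟩ := c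
  have hc' : s < 2 := hc
  rw [h0, Set.image_iUnion₂]
  interval_cases s
  · simp only [kites, List.mem_map, Set.iUnion_exists, Set.biUnion_and', Set.iUnion_iUnion_eq_right,
      iso, if_true, mul_one, map_mul, IsometryEquiv.coe_mul, Set.image_comp]
  · have h1 : hatKites 1 = (hatKites 0).map cnj := by decide
    have h2 : ∀ κ, real (cnj κ) '' Kite = cj '' (real κ '' Kite) := fun κ => by
      conv_lhs => rw [← cj_image_kite]
      rw [← Set.image_comp, ← Set.image_comp, ← IsometryEquiv.coe_mul, ← IsometryEquiv.coe_mul,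
        cj_mul_real]
    simp only [kites, h1, List.mem_map, Set.iUnion_exists, Set.biUnion_and',
      Set.iUnion_iUnion_eq_right, iso, one_ne_zero, if_false, map_mul, IsometryEquiv.coe_mul,
      Set.image_comp, h2]

theorem volume_line (f : ℂ →ₗ[ℝ] ℝ) (hf : f ≠ 0) (c : ℝ) : volume {z | f z = c} = 0 := by
  rcases Set.eq_empty_or_nonempty {z | f z = c} with h | ⟨p, hp⟩
  · rw [h, measure_empty]
  · have hp' : f p = c := hp
    have h1 : AffineSubspace.mk' p (LinearMap.ker f) ≠ ⊤ := fun h => hf <| by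
      rw [← LinearMap.ker_eq_top, ← AffineSubspace.direction_mk' p (LinearMap.ker f), h,
        AffineSubspace.direction_top]
    refine measure_mono_null (fun z hz => ?_) (Measure.addHaar_affineSubspace volume _ h1)
    have hz' : f z = c := hz
    simp [AffineSubspace.mem_mk', hp', hz']

theorem volume_pt_line (a b c : ℝ) (h : a ≠ 0 ∨ b ≠ 0) :
    volume {z | ∃ x y, z = pt x y ∧ a * x + b * y = c} = 0 := by
  let f : ℂ →ₗ[ℝ] ℝ := ((a - b) / 6) • reLm + ((a + b) / (2 * √3)) • imLm
  have hf : ∀ x y, f (pt x y) = a * x + b * y := fun x y => by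
    have : √3 ≠ 0 := by positivity
    simp [f, pt]
    field_simp
    ring
  refine measure_mono_null ?_ (volume_line f (fun h0 => ?_) c)
  · rintro z ⟨x, y, rfl, e⟩
    exact (hf x y).trans e
  · have h1 := hf 1 0
    have h2 := hf 0 1
    rw [h0] at h1 h2
    simp at h1 h2
    rcases h with h | h <;> [exact h h1.symm; exact h h2.symm]

theorem volume_kite_inter {g : Mot E} (hg : g ≠ 1) : volume (Kite ∩ real g '' Kite) = 0 := by
  refine measure_mono_null (t := {z | ∃ x y, z = pt x y ∧ 1 * x + 0 * y = 0} ∪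
    {z | ∃ x y, z = pt x y ∧ 0 * x + 1 * y = 0} ∪
    {z | ∃ x y, z = pt x y ∧ 2 * x + -1 * y = 1} ∪
    {z | ∃ x y, z = pt x y ∧ 1 * x + -2 * y = 1}) ?_ ?_
  · rintro z ⟨h1, w, h2, h3⟩
    obtain ⟨x, y, rfl⟩ := exists_pt z
    obtain ⟨u, v, rfl⟩ := exists_pt w
    rw [pt_mem_kite] at h1 h2
    rw [real_pt, pt_inj] at h3
    by_contra h4
    simp only [Set.mem_union, Set.mem_ofPred_eq, pt_inj] at h4
    have h5 : x ≠ 0 ∧ y ≠ 0 ∧ 2 * x - y ≠ 1 ∧ x - 2 * y ≠ 1 := by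
      refine ⟨?_, ?_, ?_, ?_⟩ <;> intro h <;> apply h4
      · exact Or.inl (Or.inl (Or.inl ⟨x, y, ⟨rfl, rfl⟩, by linarith⟩))
      · exact Or.inl (Or.inl (Or.inr ⟨x, y, ⟨rfl, rfl⟩, by linarith⟩))
      · exact Or.inl (Or.inr ⟨x, y, ⟨rfl, rfl⟩, by linarith⟩)
      · exact Or.inr ⟨x, y, ⟨rfl, rfl⟩, by linarith⟩
    obtain ⟨a1, a2, a3, a4⟩ := h1
    replace a1 := lt_of_le_of_ne a1 h5.1.symm
    replace a2 := lt_of_le_of_ne a2 h5.2.1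
    replace a3 := lt_of_le_of_ne a3 h5.2.2.1
    replace a4 := lt_of_le_of_ne a4 h5.2.2.2
    obtain ⟨b1, b2, b3, b4⟩ := h2
    obtain ⟨k, ⟨a, b⟩⟩ := g
    have i1 : -2 < 2 * a - b ∧ 2 * a - b < 2 ∧ -2 < 2 * b - a ∧ 2 * b - a < 2 ∧
        -2 < a + b ∧ a + b < 2 := by
      fin_cases k <;> simp [rt] at h3 <;> obtain ⟨h3, h3'⟩ := h3 <;>
        (refine ⟨?_, ?_, ?_, ?_, ?_, ?_⟩ <;> (rify; linarith))
    obtain ⟨rfl, rfl⟩ : a = 0 ∧ b = 0 := by omega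
    fin_cases k <;> simp [rt] at h3 <;> obtain ⟨h3, h3'⟩ := h3 <;> first
      | exact hg rfl
      | linarith
  · simp only [measure_union_null_iff]
    refine ⟨⟨⟨?_, ?_⟩, ?_⟩, ?_⟩ <;> exact volume_pt_line _ _ _ (by norm_num)

theorem volume_real_inter {g h : Mot E} (hgh : g ≠ h) :
    volume (real g '' Kite ∩ real h '' Kite) = 0 := by
  have e : real g '' Kite ∩ real h '' Kite = real g '' (Kite ∩ real (g⁻¹ * h) '' Kite) := by
    rw [Set.image_inter (real g).injective, ← Set.image_comp, ← IsometryEquiv.coe_mul, ← map_mul,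
      mul_inv_cancel_left]
  rw [e]
  refine addHaar_image_eq_zero_of_differentiableOn_of_addHaar_eq_zero volume ?_
    (volume_kite_inter fun h1 => hgh (inv_mul_eq_one.1 h1))
  have : (real g : ℂ → ℂ) = fun z => pt g.x.re g.x.im + (ZMod.toCircle g.k : ℂ) * z := by
    ext1 z; exact real_apply g z
  rw [this]
  fun_prop

theorem exists_mem_kite (z : ℂ) : ∃ g, z ∈ real g '' Kite := by
  obtain ⟨x, y, rfl⟩ := exists_pt z
  have h1 : ∃ a b : ℤ, |2 * (x - a) - (y - b)| ≤ 1 ∧ |2 * (y - b) - (x - a)| ≤ 1 ∧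
      |(x - a) + (y - b)| ≤ 1 := by
    obtain ⟨u, hu⟩ : ∃ u, u = x - ⌊x⌋ := ⟨_, rfl⟩
    obtain ⟨v, hv⟩ : ∃ v, v = y - ⌊y⌋ := ⟨_, rfl⟩
    have u0 : 0 ≤ u := hu ▸ Int.fract_nonneg x
    have v0 : 0 ≤ v := hv ▸ Int.fract_nonneg y
    have u1 : u < 1 := hu ▸ Int.fract_lt_one x
    have v1 : v < 1 := hv ▸ Int.fract_lt_one y
    have key : ∀ a b : ℤ, |2 * (u - a) - (v - b)| ≤ 1 ∧ |2 * (v - b) - (u - a)| ≤ 1 ∧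
        |(u - a) + (v - b)| ≤ 1 → ∃ a b : ℤ, |2 * (x - a) - (y - b)| ≤ 1 ∧
        |2 * (y - b) - (x - a)| ≤ 1 ∧ |(x - a) + (y - b)| ≤ 1 := fun a b h => by
      refine ⟨⌊x⌋ + a, ⌊y⌋ + b, ?_⟩
      push_cast
      rwa [← sub_sub, ← sub_sub, ← hu, ← hv]
    simp only [abs_le] at key ⊢
    by_cases c1 : 2 * u - v ≤ 1
    · by_cases c2 : 2 * v - u ≤ 1
      · by_cases c3 : u + v ≤ 1
        · refine key 0 0 ⟨⟨?_, ?_⟩, ⟨?_, ?_⟩, ⟨?_, ?_⟩⟩ <;> push_cast <;> linarith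
        · refine key 1 1 ⟨⟨?_, ?_⟩, ⟨?_, ?_⟩, ⟨?_, ?_⟩⟩ <;> push_cast <;> linarith
      · by_cases c3 : 2 * u ≤ v
        · refine key 0 1 ⟨⟨?_, ?_⟩, ⟨?_, ?_⟩, ⟨?_, ?_⟩⟩ <;> push_cast <;> linarith
        · refine key 1 1 ⟨⟨?_, ?_⟩, ⟨?_, ?_⟩, ⟨?_, ?_⟩⟩ <;> push_cast <;> linarith
    · by_cases c3 : 2 * v ≤ u
      · refine key 1 0 ⟨⟨?_, ?_⟩, ⟨?_, ?_⟩, ⟨?_, ?_⟩⟩ <;> push_cast <;> linarith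
      · refine key 1 1 ⟨⟨?_, ?_⟩, ⟨?_, ?_⟩, ⟨?_, ?_⟩⟩ <;> push_cast <;> linarith
  obtain ⟨a, b, h1⟩ := h1
  simp only [abs_le] at h1
  obtain ⟨⟨a1, a2⟩, ⟨a3, a4⟩, a5, a6⟩ := h1
  have key : ∀ k u v, InKite u v → x = a + ((rt k).re * u - (rt k).im * v) →
      y = b + ((rt k).im * u + ((rt k).re - (rt k).im) * v) →
      ∃ g, pt x y ∈ real g '' Kite := fun k u v h h2 h3 => by
    refine ⟨⟨k, ⟨a, b⟩⟩, pt u v, pt_mem_kite.2 h, ?_⟩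
    rw [real_pt, pt_inj]
    exact ⟨h2.symm, h3.symm⟩
  obtain ⟨u, hu⟩ : ∃ u, u = x - a := ⟨_, rfl⟩
  obtain ⟨v, hv⟩ : ∃ v, v = y - b := ⟨_, rfl⟩
  rw [← hu, ← hv] at a1 a2 a3 a4 a5 a6
  obtain rfl : x = u + a := by linarith
  obtain rfl : y = v + b := by linarith
  unfold InKite at key
  rcases le_total 0 u with c1 | c1 <;> rcases le_total 0 v with c2 | c2
  · rcases le_total u v with c3 | c3
    · apply key 2 (v - u) (-u) ⟨?_, ?_, ?_, ?_⟩ <;> (try simp [rt]) <;> linarith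
    · apply key 1 v (v - u) ⟨?_, ?_, ?_, ?_⟩ <;> (try simp [rt]) <;> linarith
  · apply key 0 u v ⟨?_, ?_, ?_, ?_⟩ <;> (try simp [rt]) <;> linarith
  · apply key 3 (-u) (-v) ⟨?_, ?_, ?_, ?_⟩ <;> (try simp [rt]) <;> linarith
  · rcases le_total u v with c3 | c3
    · apply key 4 (-v) (u - v) ⟨?_, ?_, ?_, ?_⟩ <;> (try simp [rt]) <;> linarith
    · apply key 5 (u - v) u ⟨?_, ?_, ?_, ?_⟩ <;> (try simp [rt]) <;> linarith

theorem iso_mul {g : Mot E} {c : Cell} : real g * iso c = iso (act g c) := by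
  rw [iso, iso, act, map_mul, mul_assoc]

theorem iso_injOn {c c' : Cell} (hc : c.2 < 2) (hc' : c'.2 < 2) (h : iso c = iso c') : c = c' := by
  obtain ⟨g, s⟩ := c
  obtain ⟨g', s'⟩ := c'
  simp only at hc hc'
  interval_cases s <;> interval_cases s' <;> simp [iso] at h
  · rw [real_injective h]
  · exact absurd h (real_ne_real_mul_cj _ _)
  · exact absurd h.symm (real_ne_real_mul_cj _ _)
  · rw [real_injective h]

/-- The cotiler. -/
def cotiler : Set IsomC := iso '' tiles

theorem iso_mem_cotiler {c : Cell} (hc : c.2 < 2) : iso c ∈ cotiler ↔ c ∈ tiles :=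
  ⟨fun ⟨_, h, e⟩ => iso_injOn (tiles_tag h) hc e ▸ h, fun h => ⟨c, h, rfl⟩⟩

theorem countable_cell : Countable Cell := by
  have : Function.Injective fun c : Cell => (c.1.k, c.1.x.re, c.1.x.im, c.2) := by
    rintro ⟨⟨k, ⟨a, b⟩⟩, s⟩ ⟨⟨k', ⟨a', b'⟩⟩, s'⟩ h
    simp at h
    obtain ⟨rfl, rfl, rfl, rfl⟩ := h
    rfl
  exact this.countable

theorem isHatCotiler_cotiler : IsHatCotiler cotiler := by
  have := countable_cell
  refine ⟨(Set.to_countable tiles).image _, ?_, ?_⟩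
  · rintro _ ⟨c, hc, rfl⟩ _ ⟨c', hc', rfl⟩ hne
    rw [iso_image_hat (tiles_tag hc), iso_image_hat (tiles_tag hc'), Set.iUnion₂_inter]
    refine (measure_biUnion_null_iff (List.finite_toSet _).countable).2 fun κ hκ => ?_
    rw [Set.inter_iUnion₂]
    refine (measure_biUnion_null_iff (List.finite_toSet _).countable).2 fun κ' hκ' => ?_
    refine volume_real_inter ?_
    rintro rfl
    exact hne (congrArg iso ((existsUnique_tile κ).unique ⟨hc, hκ⟩ ⟨hc', hκ'⟩))
  · have : (⋃ g ∈ cotiler, g '' Hat) = Set.univ := by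
      refine Set.eq_univ_of_forall fun z => ?_
      obtain ⟨κ, hκ⟩ := exists_mem_kite z
      obtain ⟨c, ⟨hc, hk⟩, -⟩ := existsUnique_tile κ
      refine Set.mem_biUnion ⟨c, hc, rfl⟩ ?_
      rw [iso_image_hat (tiles_tag hc)]
      exact Set.mem_biUnion hk hκ
    rw [this, Set.compl_univ, measure_empty]

theorem image_mul_eq_iff {G : Type} [Group G] {h : G} {S : Set G} :
    (fun g => h * g) '' S = S ↔ ∀ g, h * g ∈ S ↔ g ∈ S := by
  constructor
  · intro e g
    conv_lhs => rw [← e]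
    simp
  · intro e
    ext g
    constructor
    · rintro ⟨g, hg, rfl⟩
      exact (e g).2 hg
    · intro hg
      exact ⟨h⁻¹ * g, (e _).1 (by simpa using hg), by simp⟩

theorem stab_cotiler : Stab cotiler = {1, real rho, real rho * real rho} := by
  have hcj : ∀ (g : Mot E) (s : Cell), s.2 < 2 → real g * cj * iso s = iso (g * cnj s.1, 1 - s.2) := by
    rintro g ⟨k, s⟩ hs
    have h1 : cj * (real k * cj) = real (cnj k) := by
      rw [← mul_assoc, cj_mul_real, mul_assoc, cj_mul_cj, mul_one]
    simp only at hs
    interval_cases s <;> simp [iso, mul_assoc, cj_mul_real, h1]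
  ext h
  have h1 : h ∈ Stab cotiler ↔ ∀ g, h * g ∈ cotiler ↔ g ∈ cotiler := image_mul_eq_iff
  rw [h1]
  have h2 : ∀ g : Mot E, g ∈ aut → ∀ f, real g * f ∈ cotiler ↔ f ∈ cotiler := by
    have h3 : ∀ g : Mot E, g ∈ aut → ∀ f ∈ cotiler, real g * f ∈ cotiler := by
      rintro g hg _ ⟨c, hc, rfl⟩
      rw [iso_mul]
      exact ⟨_, (hg c).2 hc, rfl⟩
    refine fun g hg f => ⟨fun hf => ?_, h3 g hg f⟩
    simpa using h3 _ (aut.inv_mem hg) _ hf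
  constructor
  · intro hh
    obtain ⟨c, ⟨hc, -⟩, -⟩ := existsUnique_tile 1
    obtain ⟨c', hc', e⟩ := (hh (iso c)).2 ⟨c, hc, rfl⟩
    have h3 : (∃ g, h = real g) ∨ ∃ g, h = real g * cj := by
      have h4 : h = iso c' * (iso c)⁻¹ := by rw [e, mul_inv_cancel_right]
      have h5 : cj⁻¹ = cj := inv_eq_of_mul_eq_one_left cj_mul_cj
      have h6 : ∀ a b : Mot E, real a * (cj * real b) = real (a * cnj b) * cj := fun a b => by
        rw [cj_mul_real, map_mul, mul_assoc]
      rw [h4, iso, iso]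
      split_ifs
      · exact Or.inl ⟨c'.1 * c.1⁻¹, by simp⟩
      · refine Or.inr ⟨c'.1 * cnj c.1⁻¹, ?_⟩
        rw [← h6, mul_one, mul_inv_rev, h5, map_inv]
      · refine Or.inr ⟨c'.1 * cnj c.1⁻¹, ?_⟩
        rw [← h6, mul_one, mul_assoc, map_inv]
      · exact Or.inl ⟨c'.1 * c.1⁻¹, by simp [mul_assoc]⟩
    rcases h3 with ⟨g, rfl⟩ | ⟨g, rfl⟩
    · have h4 : g ∈ aut := fun c => by
        by_cases hs : c.2 < 2
        · rw [← iso_mem_cotiler hs, ← hh, iso_mul, iso_mem_cotiler (c := act g c) hs]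
        · exact ⟨fun h => absurd (tiles_tag h) hs, fun h => absurd (tiles_tag h) hs⟩
      rcases mem_aut_iff.1 h4 with rfl | rfl | rfl
      · exact Or.inl (map_one real)
      · exact Or.inr (Or.inl rfl)
      · exact Or.inr (Or.inr (map_mul real _ _))
    · refine absurd (fun k s hs => ?_) (not_flips g)
      rw [← iso_mem_cotiler (c := (k, s)) hs, ← hh, hcj g (k, s) hs,
        iso_mem_cotiler (c := (g * cnj k, 1 - s)) (show 1 - s < 2 by omega)]
  · rintro (rfl | rfl | rfl)
    · simp
    · exact h2 _ rho_mem_aut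
    · rw [← map_mul]
      exact h2 _ (aut.mul_mem rho_mem_aut rho_mem_aut)

/-- The quadratic form giving the norm in the coordinates of `pt`. -/
def nsq (x y : ℝ) : ℝ := x ^ 2 - x * y + y ^ 2

theorem mem_hat {x y : ℝ} : pt x y ∈ Hat ↔ ∃ κ ∈ hatKites 0, ∃ u v, InKite u v ∧
    x = κ.x.re + ((rt κ.k).re * u - (rt κ.k).im * v) ∧
    y = κ.x.im + ((rt κ.k).im * u + ((rt κ.k).re - (rt κ.k).im) * v) := by
  have h : Hat = ⋃ κ ∈ hatKites 0, real κ '' Kite := by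
    have := iso_image_hat (c := (1, 0)) (by norm_num)
    simpa [iso, kites] using this
  simp only [h, Set.mem_iUnion, exists_prop]
  refine exists_congr fun κ => and_congr_right fun _ => ?_
  constructor
  · rintro ⟨w, hw, e⟩
    obtain ⟨u, v, rfl⟩ := exists_pt w
    rw [real_pt, pt_inj] at e
    exact ⟨u, v, pt_mem_kite.1 hw, e.1.symm, e.2.symm⟩
  · rintro ⟨u, v, hw, rfl, rfl⟩
    exact ⟨pt u v, pt_mem_kite.2 hw, real_pt _ _ _⟩

/-- The smallest disc containing the hat touches it in three points. -/
theorem hat_disc {x y : ℝ} (h : pt x y ∈ Hat) : nsq (x - 1 / 8) (y + 3 / 8) < 49 / 64 ∨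
    x = -1 / 2 ∧ y = 0 ∨ x = 1 / 2 ∧ y = -1 ∨ x = 1 ∧ y = 1 / 2 := by
  obtain ⟨κ, hκ, u, v, ⟨h1, h2, h3, h4⟩, hx, hy⟩ := mem_hat.1 h
  rw [← sub_nonneg] at h3 h4
  rw [← neg_nonneg] at h2
  have m1 := mul_nonneg h1 h2
  have m2 := mul_nonneg h1 h3
  have m3 := mul_nonneg h1 h4
  have m4 := mul_nonneg h2 h3
  have m5 := mul_nonneg h2 h4
  have m6 := mul_nonneg h3 h4
  have key : u + (1 - (u - 2 * v)) ≤ 0 → u = 0 ∧ v = -1 / 2 := fun h =>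
    ⟨by linarith, by linarith⟩
  rw [or_iff_not_imp_left, not_lt]
  intro hn
  fin_cases hκ <;> simp [rt] at hx hy <;> subst hx hy <;> unfold nsq at hn <;> first
    | (exfalso; nlinarith)
    | (obtain ⟨rfl, rfl⟩ := key (by nlinarith); norm_num)

theorem not_mem_hat : pt (1 / 6) (-7 / 6) ∉ Hat := fun h => by
  obtain ⟨κ, hκ, u, v, ⟨h1, h2, h3, h4⟩, hx, hy⟩ := mem_hat.1 h
  fin_cases hκ <;> simp [rt] at hx hy <;> linarith

theorem eq_one_of_image_hat {h : IsomC} (hh : h '' Hat = Hat) : h = 1 := by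
  have hd : ∀ {x y x' y' u v u' v' : ℝ}, h (pt x y) = pt u v → h (pt x' y') = pt u' v' →
      nsq (u - u') (v - v') = nsq (x - x') (y - y') := fun {x y x' y' u v u' v'} e e' => by
    have h1 := h.dist_eq (pt x y) (pt x' y')
    rw [e, e'] at h1
    have h2 := dist_pt x y x' y'
    rw [← h1, dist_pt] at h2
    unfold nsq
    linarith
  have hA : pt (-1 / 2) 0 ∈ Hat := mem_hat.2 ⟨⟨4, 0⟩, by decide, 0, -1 / 2,
    by norm_num [InKite], by simp [rt], by simp [rt]⟩
  have hB : pt (1 / 2) (-1) ∈ Hat := mem_hat.2 ⟨⟨1, ⟨0, -1⟩⟩, by decide, 0, -1 / 2,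
    by norm_num [InKite], by simp [rt]; norm_num, by simp [rt]⟩
  have hP : pt 1 (1 / 2) ∈ Hat := mem_hat.2 ⟨⟨3, ⟨1, 0⟩⟩, by decide, 0, -1 / 2,
    by norm_num [InKite], by simp [rt], by simp [rt]; norm_num⟩
  have hQ : pt (-2 / 3) (-1 / 3) ∈ Hat := mem_hat.2 ⟨⟨4, 0⟩, by decide, 1 / 3, -1 / 3,
    by norm_num [InKite], by simp [rt]; norm_num, by simp [rt]; norm_num⟩
  have him : ∀ {x y : ℝ}, pt x y ∈ Hat → ∃ u v, h (pt x y) = pt u v ∧ pt u v ∈ Hat :=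
    fun {x y} hp => by
      obtain ⟨u, v, e⟩ := exists_pt (h (pt x y))
      exact ⟨u, v, e, e ▸ hh ▸ Set.mem_image_of_mem h hp⟩
  obtain ⟨a, a', eA, iA⟩ := him hA
  obtain ⟨b, b', eB, iB⟩ := him hB
  obtain ⟨p, p', eP, iP⟩ := him hP
  obtain ⟨q, q', eQ, iQ⟩ := him hQ
  obtain ⟨z, hz⟩ := h.surjective (pt (1 / 8) (-3 / 8))
  obtain ⟨o, o', rfl⟩ := exists_pt z
  have dA := hd eA hz
  have dB := hd eB hz
  have dP := hd eP hz
  have hle : ∀ {x y : ℝ}, pt x y ∈ Hat → nsq (x - 1 / 8) (y - -3 / 8) ≤ 49 / 64 :=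
    fun {x y} hp => by
      rcases hat_disc hp with h | ⟨rfl, rfl⟩ | ⟨rfl, rfl⟩ | ⟨rfl, rfl⟩
      · rw [show y - -3 / 8 = y + 3 / 8 by ring]
        exact h.le
      all_goals norm_num [nsq]
  have h1 : nsq (o - 1 / 8) (o' + 3 / 8) ≤ 0 := by
    have := hle iA
    have := hle iB
    have := hle iP
    unfold nsq at *
    linarith
  have h2 : o = 1 / 8 ∧ o' = -3 / 8 := by
    have h3 : (o' + 3 / 8) ^ 2 = 0 := by
      unfold nsq at h1
      nlinarith [sq_nonneg (2 * (o - 1 / 8) - (o' + 3 / 8)), sq_nonneg (o' + 3 / 8)]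
    have h4 : (o - 1 / 8) ^ 2 = 0 := by
      unfold nsq at h1
      nlinarith [sq_nonneg (2 * (o' + 3 / 8) - (o - 1 / 8)), sq_nonneg (o - 1 / 8)]
    constructor <;> nlinarith
  obtain ⟨rfl, rfl⟩ := h2
  have dAB := hd eA eB
  have dAP := hd eA eP
  have dBP := hd eB eP
  have hT : ∀ {x y : ℝ}, pt x y ∈ Hat → nsq (x - 1 / 8) (y - -3 / 8) = 49 / 64 →
      x = -1 / 2 ∧ y = 0 ∨ x = 1 / 2 ∧ y = -1 ∨ x = 1 ∧ y = 1 / 2 := fun {x y} hp e =>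
    (hat_disc hp).resolve_left (by
      rw [← e, not_lt]
      apply le_of_eq
      congr 1
      ring)
  have tA := hT iA (dA.trans (by norm_num [nsq]))
  have tB := hT iB (dB.trans (by norm_num [nsq]))
  have tP := hT iP (dP.trans (by norm_num [nsq]))
  clear dA dB dP hz h1 iA iB iP
  rcases tA with ⟨rfl, rfl⟩ | ⟨rfl, rfl⟩ | ⟨rfl, rfl⟩ <;>
    rcases tB with ⟨rfl, rfl⟩ | ⟨rfl, rfl⟩ | ⟨rfl, rfl⟩ <;>
    rcases tP with ⟨rfl, rfl⟩ | ⟨rfl, rfl⟩ | ⟨rfl, rfl⟩ <;>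
    first
    | (norm_num [nsq] at dAB; done)
    | (norm_num [nsq] at dAP; done)
    | (norm_num [nsq] at dBP; done)
    | skip
  · ext1 w
    obtain ⟨x, y, rfl⟩ := exists_pt w
    obtain ⟨u, v, e⟩ := exists_pt (h (pt x y))
    have h1 := hd e eA
    have h2 := hd e eB
    have h3 := hd e eP
    unfold nsq at h1 h2 h3
    rw [e]
    show pt u v = pt x y
    rw [pt_inj]
    constructor <;> linarith
  · have h1 := hd eQ eA
    have h2 := hd eQ eB
    have h3 := hd eQ eP
    unfold nsq at h1 h2 h3
    obtain rfl : q = 1 / 6 := by linarith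
    obtain rfl : q' = -7 / 6 := by linarith
    exact absurd iQ not_mem_hat

theorem symGrp_hatTiling (C : Set IsomC) : SymGrp (hatTiling C) = Stab C := by
  have hinj : Function.Injective fun g : IsomC => g '' Hat := fun g k e => by
    refine (inv_mul_eq_one.1 (eq_one_of_image_hat (h := g⁻¹ * k) ?_))
    have e₁ : g '' Hat = k '' Hat := e
    rw [IsometryEquiv.coe_mul, Set.image_comp, ← e₁, ← Set.image_comp, ← IsometryEquiv.coe_mul,
      inv_mul_cancel]
    exact Set.image_id _
  ext h
  have h1 : (fun S : Set ℂ => h '' S) '' hatTiling C = hatTiling ((fun g => h * g) '' C) := by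
    rw [hatTiling, hatTiling, ← Set.image_comp, ← Set.image_comp]
    refine Set.image_congr fun g _ => ?_
    simp [IsometryEquiv.coe_mul, Set.image_comp]
  show (fun S : Set ℂ => h '' S) '' hatTiling C = hatTiling C ↔ (fun g => h * g) '' C = C
  rw [h1, hatTiling, hatTiling, hinj.image_injective.eq_iff]

end HatC

theorem statement_3 :
    ∃ (C : Set IsomC) (c : ℂ),
      IsHatCotiler C ∧
      Stab C = {1, rotAbout (2 * Real.pi / 3) c,
        rotAbout (2 * Real.pi / 3) c * rotAbout (2 * Real.pi / 3) c} ∧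
      SymGrp (hatTiling C) = {1, rotAbout (2 * Real.pi / 3) c,
        rotAbout (2 * Real.pi / 3) c * rotAbout (2 * Real.pi / 3) c} := by
  refine ⟨HatC.cotiler, HatC.pt (7 / 3) (2 / 3), HatC.isHatCotiler_cotiler, ?_, ?_⟩
  · rw [HatC.rotAbout_eq_real, HatC.stab_cotiler]
  · rw [HatC.symGrp_hatTiling, HatC.rotAbout_eq_real, HatC.stab_cotiler]

end
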